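/- arXiv:1708.06951 — 3 statements merged into one kernel-verified Lean document; each statement's English description precedes it below -/
import Mathlib

section
/- van der Waerden's Theorem: Fix integers m ≥ 2 and ℓ ≥ 3. For every coloring of the positive integers with m colors (i.e., every function from the positive integers to a set of m colors), there exist a positive integer a and a positive integer d such that the ℓ-term arithmetic progression a, a + d, a + 2d, …, a + (ℓ−1)d is monochromatic (all terms receive the same color). -/
theorem van_der_waerden (m ℓ : ℕ) (hm : 2 ≤ m) (hℓ : 3 ≤ ℓ)
    (α : Type) [Fintype α] (hcard : Fintype.card α = m)
    (f : ℕ → α) :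
    ∃ a d : ℕ, 0 < a ∧ 0 < d ∧ ∀ i : ℕ, i < ℓ → f (a + i * d) = f a := by
  obtain ⟨d, hd, b, c, h⟩ :=
    Combinatorics.exists_mono_homothetic_copy (Finset.range ℓ) (fun n => f (n + 1))
  refine ⟨b + 1, d, Nat.succ_pos b, hd, fun i hi => ?_⟩
  have h1 := h i (Finset.mem_range.2 hi)
  have h0 := h 0 (Finset.mem_range.2 (by omega))
  simp only [smul_eq_mul, mul_zero, zero_add] at h0 h1
  rw [h0, ← h1]
  congr 1
  ring
end

section
/- Szemerédi's Theorem: Fix a real number δ > 0 and an integer ℓ ≥ 3. There exists N₀ (depending on δ and ℓ) such that for every integer N ≥ N₀, every subset A of {1, 2, …, N} with at least δ·N elements contains an ℓ-term arithmetic progression, i.e., there exist integers a and d ≥ 1 with a + i·d ∈ A for all 0 ≤ i ≤ ℓ−1. -/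
namespace SZ

abbrev Sb (η α ι : Type) := Combinatorics.Subspace η α ι

/-- indicator of a proposition -/
noncomputable def ind (p : Prop) : ℝ := by
  classical
  exact if p then 1 else 0

lemma ind_true {p : Prop} (h : p) : ind p = 1 := by simp [ind, h]
lemma ind_false {p : Prop} (h : ¬ p) : ind p = 0 := by simp [ind, h]
lemma ind_nonneg (p : Prop) : 0 ≤ ind p := by
  by_cases h : p <;> simp [ind, h]
lemma ind_le_one (p : Prop) : ind p ≤ 1 := by
  by_cases h : p <;> simp [ind, h]
lemma ind_mono {p q : Prop} (h : p → q) : ind p ≤ ind q := by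
  by_cases hp : p
  · rw [ind_true hp, ind_true (h hp)]
  · rw [ind_false hp]; exact ind_nonneg q
lemma ind_congr {p q : Prop} (h : p ↔ q) : ind p = ind q := by rw [propext h]
lemma ind_and (p q : Prop) : ind (p ∧ q) = ind p * ind q := by
  by_cases hp : p <;> by_cases hq : q <;> simp [ind, hp, hq]
lemma ind_not (p : Prop) : ind (¬ p) = 1 - ind p := by
  by_cases hp : p <;> simp [ind, hp]

/-- average over a finite type -/
noncomputable def ev {X : Type} [Finite X] (f : X → ℝ) : ℝ :=
  letI := Fintype.ofFinite X
  (∑ x, f x) / (Nat.card X : ℝ)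

section ev
variable {X Y : Type} [Finite X] [Finite Y]

lemma ev_eq [h : Fintype X] (f : X → ℝ) : ev f = (∑ x, f x) / (Nat.card X : ℝ) := by
  have : Fintype.ofFinite X = h := Subsingleton.elim _ _
  unfold ev
  rw [this]

lemma ev_add (f g : X → ℝ) : ev (fun x => f x + g x) = ev f + ev g := by
  cases nonempty_fintype X
  simp only [ev_eq, Finset.sum_add_distrib, add_div]

lemma ev_sub (f g : X → ℝ) : ev (fun x => f x - g x) = ev f - ev g := by
  cases nonempty_fintype X
  simp only [ev_eq, Finset.sum_sub_distrib, sub_div]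

lemma ev_mul (c : ℝ) (f : X → ℝ) : ev (fun x => c * f x) = c * ev f := by
  cases nonempty_fintype X
  simp only [ev_eq, ← Finset.mul_sum, mul_div_assoc]

lemma ev_const [Nonempty X] (c : ℝ) : ev (fun _ : X => c) = c := by
  cases nonempty_fintype X
  have : (Nat.card X : ℝ) ≠ 0 := by
    simp
  rw [ev_eq]
  simp only [Finset.sum_const, Finset.card_univ, nsmul_eq_mul, Nat.card_eq_fintype_card] at *
  field_simp

lemma ev_mono {f g : X → ℝ} (h : ∀ x, f x ≤ g x) : ev f ≤ ev g := by
  cases nonempty_fintype X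
  simp only [ev_eq]
  gcongr with x
  exact h x

lemma ev_nonneg {f : X → ℝ} (h : ∀ x, 0 ≤ f x) : 0 ≤ ev f := by
  cases nonempty_fintype X
  rw [ev_eq]
  exact div_nonneg (Finset.sum_nonneg fun x _ => h x) (Nat.cast_nonneg _)

lemma ev_le_const {f : X → ℝ} {c : ℝ} (hc : 0 ≤ c) (h : ∀ x, f x ≤ c) : ev f ≤ c := by
  rcases isEmpty_or_nonempty X with hX | hX
  · cases nonempty_fintype X
    rw [ev_eq]; simpa using hc
  · exact (ev_mono h).trans (ev_const c).le

lemma const_le_ev [Nonempty X] {f : X → ℝ} {c : ℝ} (h : ∀ x, c ≤ f x) : c ≤ ev f :=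
  (ev_const (X := X) c).symm.le.trans (ev_mono h)

lemma ev_equiv (e : X ≃ Y) (f : Y → ℝ) : ev f = ev (fun x => f (e x)) := by
  cases nonempty_fintype X
  cases nonempty_fintype Y
  rw [ev_eq, ev_eq, Nat.card_congr e, Equiv.sum_comp e f]

lemma ev_prod (f : X × Y → ℝ) : ev f = ev (fun x => ev (fun y => f (x, y))) := by
  cases nonempty_fintype X
  cases nonempty_fintype Y
  simp only [ev_eq]
  rw [Fintype.sum_prod_type, Nat.card_prod, ← Finset.sum_div, div_div, mul_comm, Nat.cast_mul]

lemma ev_comm (f : X → Y → ℝ) : ev (fun x => ev (fun y => f x y)) = ev (fun y => ev (fun x => f x y)) := by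
  rw [← ev_prod (fun p : X × Y => f p.1 p.2), ← ev_prod (fun p : Y × X => f p.2 p.1),
    ev_equiv (Equiv.prodComm X Y)]
  rfl

lemma ev_finset_sum {I : Type} (s : Finset I) (f : I → X → ℝ) :
    ev (fun x => ∑ i ∈ s, f i x) = ∑ i ∈ s, ev (f i) := by
  cases nonempty_fintype X
  simp only [ev_eq]
  rw [Finset.sum_comm, Finset.sum_div]

lemma exists_ev_le [Nonempty X] (f : X → ℝ) : ∃ x, ev f ≤ f x := by
  by_contra! h
  cases nonempty_fintype X
  have h2 : ∑ x, f x < ∑ _x : X, ev f := Finset.sum_lt_sum_of_nonempty Finset.univ_nonempty fun x _ => h x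
  have h3 : 0 < (Nat.card X : ℝ) := by exact_mod_cast Nat.card_pos
  rw [Finset.sum_const, nsmul_eq_mul, Finset.card_univ, ← Nat.card_eq_fintype_card, ev_eq] at h2
  field_simp at h2
  exact lt_irrefl _ h2

/-- if the average is at least `l` and all values at most `l + e`, no value is much smaller. -/
lemma ev_all_ge {f : X → ℝ} {l e : ℝ} (he : 0 ≤ e) (h1 : l ≤ ev f) (h2 : ∀ x, f x ≤ l + e) (x : X) :
    l - Nat.card X * e ≤ f x := by
  classical
  cases nonempty_fintype X
  have h3 : 0 < (Nat.card X : ℝ) := by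
    have : Nonempty X := ⟨x⟩
    exact_mod_cast Nat.card_pos
  rw [ev_eq, le_div_iff₀ h3] at h1
  rw [← Finset.add_sum_erase _ _ (Finset.mem_univ x)] at h1
  have h4 : ∑ y ∈ Finset.univ.erase x, f y ≤ ∑ y ∈ Finset.univ.erase x, (l + e) :=
    Finset.sum_le_sum fun y _ => h2 y
  rw [Finset.sum_const, nsmul_eq_mul, Finset.card_erase_of_mem (Finset.mem_univ x), Finset.card_univ,
    Nat.cast_sub (by rw [Nat.card_eq_fintype_card] at h3; exact_mod_cast h3),
    ← Nat.card_eq_fintype_card] at h4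
  push_cast at h4
  nlinarith

/-- pigeonhole -/
lemma pick {I : Type} [Finite I] (g : Y → ℝ) (S : I → Set Y) {c : ℝ} (hc : 0 < c)
    (hg : ∀ y, g y ≤ 1) (h : ∀ y, c ≤ g y → ∃ i, y ∈ S i) (hE : 2 * c ≤ ev g) :
    ∃ i, c / (Nat.card I + 1) ≤ ev (fun y => ind (y ∈ S i)) := by
  by_contra! hcon
  cases nonempty_fintype I
  have h1 : ∀ y, g y ≤ c + ∑ i, ind (y ∈ S i) := by
    intro y
    by_cases hy : c ≤ g y
    · obtain ⟨i, hi⟩ := h y hy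
      have := Finset.single_le_sum (f := fun i => ind (y ∈ S i)) (fun i _ => ind_nonneg _) (Finset.mem_univ i)
      simp only [ind_true hi] at this
      linarith [hg y]
    · have := Finset.sum_nonneg (s := Finset.univ) (f := fun i => ind (y ∈ S i)) (fun i _ => ind_nonneg _)
      linarith
  have h2 := ev_mono h1
  rw [ev_add, ev_finset_sum] at h2
  have h3 : ev (fun _ : Y => c) ≤ c := ev_le_const hc.le fun _ => le_rfl
  have h4 : ∑ i, ev (fun y => ind (y ∈ S i)) ≤ ∑ i : I, c / (Nat.card I + 1) :=
    Finset.sum_le_sum fun i _ => (hcon i).le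
  rw [Finset.sum_const, nsmul_eq_mul, Finset.card_univ, ← Nat.card_eq_fintype_card] at h4
  have h5 : (Nat.card I : ℝ) * (c / (Nat.card I + 1)) < c := by
    have : (0:ℝ) ≤ Nat.card I := Nat.cast_nonneg _
    rw [← mul_div_assoc, div_lt_iff₀ (by linarith)]
    nlinarith
  linarith

/-- averages over the image of an injection -/
lemma ev_range (φ : X → Y) (hφ : Function.Injective φ) (h : Y → ℝ) :
    ev (fun y => h y * ind (y ∈ Set.range φ)) =
      (Nat.card X / Nat.card Y : ℝ) * ev (fun x => h (φ x)) := by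
  classical
  cases nonempty_fintype X
  cases nonempty_fintype Y
  have h1 : ∑ y, h y * ind (y ∈ Set.range φ) = ∑ x, h (φ x) := by
    rw [← Finset.sum_image (s := Finset.univ) (g := φ) (f := h) (fun a _ b _ hab => hφ hab)]
    symm
    apply Finset.sum_subset_zero_on_sdiff (Finset.subset_univ _)
    · intro y hy
      rw [ind_false, mul_zero]
      simpa using hy
    · intro y hy
      rw [ind_true, mul_one]
      simpa using hy
  rw [ev_eq, ev_eq, h1]
  rcases isEmpty_or_nonempty X with hX | hX
  · simp
  · have : (Nat.card X : ℝ) ≠ 0 := by exact_mod_cast Nat.card_pos.ne'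
    field_simp

end ev

lemma ev_sum {β ι₁ ι₂ : Type} [Finite β] [Finite ι₁] [Finite ι₂] (f : (ι₁ ⊕ ι₂ → β) → ℝ) :
    ev f = ev (fun x : ι₁ → β => ev (fun y : ι₂ → β => f (Sum.elim x y))) := by
  rw [ev_equiv (Equiv.sumArrowEquivProdArrow ι₁ ι₂ β).symm, ev_prod]
  rfl

section sub
variable {η ζ α ι ι₁ ι₂ : Type}

instance [Finite η] [Finite α] [Finite ι] : Finite (Sb η α ι) :=
  Finite.of_injective (fun V => V.idxFun) fun V W h => by
    cases V; cases W; simp_all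

def comp (V : Sb η α ι) (W : Sb ζ α η) : Sb ζ α ι where
  idxFun i := (V.idxFun i).elim Sum.inl W.idxFun
  proper e := by
    obtain ⟨j, hj⟩ := W.proper e
    obtain ⟨i, hi⟩ := V.proper j
    exact ⟨i, by simp [hi, hj]⟩

lemma comp_apply (V : Sb η α ι) (W : Sb ζ α η) (x : ζ → α) : comp V W x = V (W x) := by
  ext i
  simp only [Combinatorics.Subspace.coe_apply, comp]
  cases h : V.idxFun i <;> simp [Combinatorics.Subspace.coe_apply]

def padL (x : ι₁ → α) : Sb ι₂ α (ι₁ ⊕ ι₂) where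
  idxFun := Sum.elim (fun i => Sum.inl (x i)) Sum.inr
  proper e := ⟨Sum.inr e, rfl⟩

def padR (y : ι₂ → α) : Sb ι₁ α (ι₁ ⊕ ι₂) where
  idxFun := Sum.elim Sum.inr (fun i => Sum.inl (y i))
  proper e := ⟨Sum.inl e, rfl⟩

lemma padL_apply (x : ι₁ → α) (y : ι₂ → α) : padL x y = Sum.elim x y := by
  ext i; cases i <;> rfl

lemma padR_apply (x : ι₁ → α) (y : ι₂ → α) : padR y x = Sum.elim x y := by
  ext i; cases i <;> rfl

def prodS (V : Sb η α ι₁) (W : Sb ζ α ι₂) : Sb (η ⊕ ζ) α (ι₁ ⊕ ι₂) where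
  idxFun := Sum.elim (fun i => (V.idxFun i).map id Sum.inl) (fun i => (W.idxFun i).map id Sum.inr)
  proper e := by
    rcases e with e | e
    · obtain ⟨i, hi⟩ := V.proper e
      exact ⟨Sum.inl i, by simp [hi]⟩
    · obtain ⟨i, hi⟩ := W.proper e
      exact ⟨Sum.inr i, by simp [hi]⟩

lemma prodS_apply (V : Sb η α ι₁) (W : Sb ζ α ι₂) (x : η ⊕ ζ → α) :
    prodS V W x = Sum.elim (V (x ∘ Sum.inl)) (W (x ∘ Sum.inr)) := by
  ext i
  rcases i with i | i
  · simp only [Combinatorics.Subspace.coe_apply, prodS, Sum.elim_inl]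
    cases V.idxFun i <;> simp
  · simp only [Combinatorics.Subspace.coe_apply, prodS, Sum.elim_inr]
    cases W.idxFun i <;> simp

lemma sb_inj (V : Sb η α ι) : Function.Injective (fun x : η → α => V x) := by
  intro x y h
  ext e
  obtain ⟨i, hi⟩ := V.proper e
  have := congrFun h i
  simpa [Combinatorics.Subspace.coe_apply, hi] using this

/-- extend the alphabet -/
def up (V : Sb η α ι) : Sb η (Option α) ι where
  idxFun i := (V.idxFun i).map some id
  proper e := by
    obtain ⟨i, hi⟩ := V.proper e
    exact ⟨i, by simp [hi]⟩

lemma up_getD (V : Sb η α ι) (z : η → Option α) (a : α) (i : ι) :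
    (up V z i).getD a = V (fun j => (z j).getD a) i := by
  simp only [Combinatorics.Subspace.coe_apply, up]
  cases V.idxFun i <;> simp

lemma up_some (V : Sb η α ι) (z : η → α) (i : ι) :
    up V (fun j => some (z j)) i = some (V z i) := by
  simp only [Combinatorics.Subspace.coe_apply, up]
  cases V.idxFun i <;> simp

lemma up_none (V : Sb η α ι) (z : η → Option α) (h : ∃ j, z j = none) : ∃ i, up V z i = none := by
  obtain ⟨j, hj⟩ := h
  obtain ⟨i, hi⟩ := V.proper j
  exact ⟨i, by simp [Combinatorics.Subspace.coe_apply, up, hi, hj]⟩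

lemma up_comp (V : Sb η α ι) (W : Sb ζ α η) (z : ζ → Option α) :
    up (comp V W) z = up V (up W z) := by
  ext1 i
  simp only [Combinatorics.Subspace.coe_apply, up, comp]
  cases V.idxFun i <;> simp [Combinatorics.Subspace.coe_apply]

end sub

/-- multidimensional density Hales-Jewett -/
def MD (η α : Type) : Prop :=
  ∀ δ : ℝ, 0 < δ → ∃ (ι : Type) (_ : Finite ι) (_ : Finite (ι → α)), ∀ A : Set (ι → α),
    δ ≤ ev (fun x => ind (x ∈ A)) → ∃ V : Sb η α ι, ∀ x, V x ∈ A

lemma MD_sum {η ζ α : Type} [Finite η] [Finite α] (h1 : MD η α) (h2 : MD ζ α) : MD (η ⊕ ζ) α := by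
  intro δ hδ
  obtain ⟨ι₁, f₁, _, H1⟩ := h1 (δ / 2) (by linarith)
  set K := Nat.card (Sb η α ι₁)
  obtain ⟨ι₂, f₂, _, H2⟩ := h2 (δ / 2 / (K + 1)) (by positivity)
  refine ⟨ι₁ ⊕ ι₂, inferInstance, inferInstance, fun A hA => ?_⟩
  rw [ev_sum, ev_comm] at hA
  obtain ⟨V, hV⟩ := pick (fun y => ev fun x : ι₁ → α => ind (Sum.elim x y ∈ A))
    (fun V : Sb η α ι₁ => {y : ι₂ → α | ∀ x, Sum.elim (V x) y ∈ A}) (c := δ / 2) (by linarith)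
    (fun y => ev_le_const zero_le_one fun x => ind_le_one _)
    (fun y hy => H1 {x | Sum.elim x y ∈ A} hy) (by linarith)
  obtain ⟨W, hW⟩ := H2 _ hV
  exact ⟨prodS V W, fun x => by rw [prodS_apply]; exact hW _ _⟩

lemma MD_all {α : Type} [Finite α] (h : MD Unit α) (η : Type) [Finite η] : MD η α := by
  induction η using Finite.induction_empty_option with
  | of_equiv e ih =>
    intro δ hδ
    obtain ⟨ι, f, f', H⟩ := ih δ hδ
    refine ⟨ι, f, f', fun A hA => ?_⟩
    obtain ⟨V, hV⟩ := H A hA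
    refine ⟨V.reindex e (Equiv.refl α) (Equiv.refl ι), fun x => ?_⟩
    convert hV (x ∘ e) using 1
    ext i
    simp
  | h_empty =>
    intro δ hδ
    refine ⟨Empty, inferInstance, inferInstance, fun A hA => ⟨⟨Empty.elim, fun e => e.elim⟩, fun x => ?_⟩⟩
    by_contra hx
    have : ev (fun x => ind (x ∈ A)) ≤ 0 := ev_le_const le_rfl fun y => by
      rw [ind_false]
      rwa [Subsingleton.elim y]
    linarith
  | h_option ih =>
    rename_i η' _
    have := MD_sum ih h
    intro δ hδ
    obtain ⟨ι, f, f', H⟩ := this δ hδ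
    refine ⟨ι, f, f', fun A hA => ?_⟩
    obtain ⟨V, hV⟩ := H A hA
    refine ⟨V.reindex (Equiv.optionEquivSumPUnit η').symm (Equiv.refl α) (Equiv.refl ι), fun x => ?_⟩
    convert hV (x ∘ (Equiv.optionEquivSumPUnit η').symm) using 1
    ext i
    simp

end SZ

namespace SZ

/-- reindexing the dimensions of a subspace -/
def reix {η η' α ι : Type} (e : η ≃ η') (V : Sb η α ι) : Sb η' α ι where
  idxFun i := (V.idxFun i).map id e
  proper j := by
    obtain ⟨i, hi⟩ := V.proper (e.symm j)
    exact ⟨i, by simp [hi]⟩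

lemma up_reix {η η' α ι : Type} (e : η ≃ η') (V : Sb η α ι) (z : η' → Option α) :
    up (reix e V) z = up V (z ∘ e) := by
  ext1 i
  simp only [Combinatorics.Subspace.coe_apply, up, reix]
  cases V.idxFun i <;> simp

/-- colour depends only on the pattern of `none` -/
def PA (α η : Type) : Prop :=
  ∀ κ : Type, Finite κ → ∃ (ι : Type) (_ : Finite ι), ∀ χ : (ι → Option α) → κ,
    ∃ V : Sb η α ι, ∀ z z' : η → Option α, (∀ i, z i = none ↔ z' i = none) →
      χ (up V z) = χ (up V z')

lemma PA_equiv {α η η' : Type} (e : η ≃ η') (h : PA α η) : PA α η' := by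
  intro κ hκ
  obtain ⟨ι, f, H⟩ := h κ hκ
  refine ⟨ι, f, fun χ => ?_⟩
  obtain ⟨V, hV⟩ := H χ
  refine ⟨reix e V, fun z z' hz => ?_⟩
  rw [up_reix, up_reix]
  exact hV _ _ fun i => hz _

lemma up_prodS {η ζ α ι₁ ι₂ : Type} (V : Sb η α ι₁) (W : Sb ζ α ι₂) (z : η ⊕ ζ → Option α) :
    up (prodS V W) z = Sum.elim (up V (z ∘ Sum.inl)) (up W (z ∘ Sum.inr)) := by
  ext1 i
  rcases i with i | i
  · simp only [Combinatorics.Subspace.coe_apply, up, prodS, Sum.elim_inl]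
    cases V.idxFun i <;> simp
  · simp only [Combinatorics.Subspace.coe_apply, up, prodS, Sum.elim_inr]
    cases W.idxFun i <;> simp

lemma PA_add {α η : Type} [Finite α] [Nonempty α] (h : PA α η) : PA α (η ⊕ Unit) := by
  intro κ hκ
  obtain ⟨ι₁, f₁, H⟩ := h (κ × κ) inferInstance
  obtain ⟨ι₂, f₂, H2⟩ := Combinatorics.Subspace.exists_mono_in_high_dimension α ((ι₁ → Option α) → κ) Unit
  refine ⟨ι₁ ⊕ ι₂, inferInstance, fun χ => ?_⟩
  obtain ⟨L, c, hL⟩ := H2 (fun y u => χ (Sum.elim u (fun i => some (y i))))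
  obtain ⟨V, hV⟩ := H (fun u => (c u, χ (Sum.elim u (up L (fun _ => none)))))
  refine ⟨prodS V L, fun z z' hz => ?_⟩
  rw [up_prodS, up_prodS]
  have h1 := hV (z ∘ Sum.inl) (z' ∘ Sum.inl) (fun i => hz _)
  simp only [Prod.mk.injEq] at h1
  have key : ∀ (u : ι₁ → Option α) (w : Unit → Option α), w () ≠ none →
      χ (Sum.elim u (up L w)) = c u := by
    intro u w hw
    obtain ⟨a, ha⟩ := Option.ne_none_iff_exists'.1 hw
    rw [← hL (fun _ => a)]
    congr 2
    ext1 i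
    rw [← up_some]
    congr 1
    ext1 j
    exact ha
  by_cases hn : z (Sum.inr ()) = none
  · have hn' := (hz _).1 hn
    have e1 : z ∘ Sum.inr = fun _ => none := by ext1 j; exact hn
    have e2 : z' ∘ Sum.inr = fun _ => none := by ext1 j; exact hn'
    rw [e1, e2]
    exact h1.2
  · have hn' : z' (Sum.inr ()) ≠ none := fun h => hn ((hz _).2 h)
    rw [key _ _ hn, key _ _ hn']
    exact h1.1

lemma PA_all {α : Type} [Finite α] [Nonempty α] (η : Type) [Finite η] : PA α η := by
  induction η using Finite.induction_empty_option with
  | of_equiv e ih => exact PA_equiv e ih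
  | h_empty =>
    intro κ hκ
    refine ⟨Empty, inferInstance, fun χ => ⟨⟨Empty.elim, fun e => e.elim⟩, fun z z' _ => ?_⟩⟩
    congr 1
    ext i
    exact i.elim
  | h_option ih =>
    rename_i η' _
    exact PA_equiv (Equiv.optionEquivSumPUnit η').symm (PA_add ih)

/-- finite unions, colours determined by the minimum -/
lemma FU_min (m : ℕ) : ∃ (η : Type) (_ : Finite η), ∀ G : Set (Set η),
    ∃ (s : η → Option (Fin m)) (c : Fin m → Prop), (∀ j, ∃ i, s i = some j) ∧
      ∀ (j : Fin m) (I : Set (Fin m)), j ∈ I → (∀ i < j, i ∉ I) →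
        ({x | ∃ i ∈ I, s x = some i} ∈ G ↔ c j) := by
  induction m with
  | zero => exact ⟨Empty, inferInstance, fun G => ⟨Empty.elim, fun _ => True, fun j => j.elim0, fun j => j.elim0⟩⟩
  | succ m ih =>
    obtain ⟨η, f, H⟩ := ih
    obtain ⟨ι, fι, H2⟩ := Combinatorics.Subspace.exists_mono_in_high_dimension Bool Prop η
    refine ⟨Option ι, inferInstance, fun G => ?_⟩
    obtain ⟨W, c0, hW⟩ := H2 (fun w => {x : Option ι | ∀ i, x = some i → w i = true} ∈ G)
    obtain ⟨s', c', hs', hc'⟩ := H {P | {x : Option ι | ∃ i e, x = some i ∧ W.idxFun i = Sum.inr e ∧ e ∈ P} ∈ G}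
    let s : Option ι → Option (Fin (m + 1)) := fun x =>
      match x with
      | none => some 0
      | some i => match W.idxFun i with
        | Sum.inl true => some 0
        | Sum.inl false => none
        | Sum.inr e => (s' e).map Fin.succ
    have sr : ∀ i e, W.idxFun i = Sum.inr e → s (some i) = (s' e).map Fin.succ := by
      intro i e h; simp only [s, h]
    have st : ∀ i, W.idxFun i = Sum.inl true → s (some i) = some 0 := by
      intro i h; simp only [s, h]
    have sf : ∀ i, W.idxFun i = Sum.inl false → s (some i) = none := by
      intro i h; simp only [s, h]
    refine ⟨s, Fin.cons c0 c', ?_, ?_⟩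
    · intro j
      refine Fin.cases ⟨none, rfl⟩ (fun j => ?_) j
      obtain ⟨e, he⟩ := hs' j
      obtain ⟨i, hi⟩ := W.proper e
      exact ⟨some i, by rw [sr i e hi, he]; rfl⟩
    · intro j I hj hI
      by_cases h0 : (0 : Fin (m+1)) ∈ I
      · have hj0 : j = 0 := by
          by_contra hne
          exact hI 0 (Fin.pos_of_ne_zero hne) h0
        subst hj0
        classical
        rw [Fin.cons_zero, ← hW (fun e => decide (∃ i ∈ I, (s' e).map Fin.succ = some i))]
        apply iff_of_eq
        congr 1
        ext x
        simp only [Set.mem_ofPred_eq]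
        rcases x with _ | i
        · simp only [reduceCtorEq, false_implies, implies_true, iff_true]
          exact ⟨0, h0, rfl⟩
        · simp only [Option.some.injEq, forall_eq', Combinatorics.Subspace.coe_apply]
          rcases hi : W.idxFun i with b | e
          · cases b
            · simp [sf i hi]
            · simp [st i hi, h0]
          · simp [sr i e hi]
      · obtain ⟨j', rfl⟩ := Fin.exists_succ_eq.2 (show j ≠ 0 by rintro rfl; exact h0 hj)
        rw [Fin.cons_succ, ← hc' j' (Fin.succ ⁻¹' I) hj (fun i hi => hI _ (Fin.succ_lt_succ_iff.2 hi))]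
        simp only [Set.mem_ofPred_eq]
        apply iff_of_eq
        congr 1
        ext x
        simp only [Set.mem_ofPred_eq]
        rcases x with _ | i
        · simp only [reduceCtorEq, false_and, exists_false, iff_false, not_exists, not_and]
          intro i hi h
          have : i = 0 := by simpa [s] using h.symm
          exact h0 (this ▸ hi)
        · rcases hi : W.idxFun i with b | e
          · cases b
            · simp [sf i hi, hi]
            · simp [st i hi, h0, hi]
          · simp only [sr i e hi, Option.map_eq_some_iff, Option.some.injEq, hi, Set.mem_preimage]
            constructor
            · rintro ⟨q, hq, a, ha, rfl⟩
              exact ⟨i, e, rfl, by rw [hi], a, hq, ha⟩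
            · rintro ⟨i', e', rfl, he, a, ha, ha'⟩
              rw [hi] at he
              cases he
              exact ⟨_, ha, a, ha', rfl⟩

/-- finite unions theorem -/
lemma FU (ζ : Type) [Finite ζ] : ∃ (η : Type) (_ : Finite η), ∀ G : Set (Set η),
    ∃ s : η → Option ζ, (∀ j, ∃ i, s i = some j) ∧
      ((∀ I : Set ζ, I.Nonempty → {x | ∃ i ∈ I, s x = some i} ∈ G) ∨
       (∀ I : Set ζ, I.Nonempty → {x | ∃ i ∈ I, s x = some i} ∉ G)) := by
  classical
  cases nonempty_fintype ζ
  obtain ⟨η, f, H⟩ := FU_min (2 * Fintype.card ζ)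
  refine ⟨η, f, fun G => ?_⟩
  obtain ⟨s, c, hs, hc⟩ := H G
  have h1 : ∃ (p : Prop) (e : ζ ↪ Fin (2 * Fintype.card ζ)), ∀ j, c (e j) ↔ p := by
    obtain ⟨p, hp⟩ := Fintype.exists_le_card_fiber_of_mul_le_card (α := Fin (2 * Fintype.card ζ)) (β := Prop)
      c (n := Fintype.card ζ) (by simp)
    obtain ⟨T, hT, hTp⟩ : ∃ T : Finset (Fin (2 * Fintype.card ζ)), Fintype.card ζ ≤ T.card ∧
        ∀ x ∈ T, c x = p := ⟨_, hp, fun x hx => (Finset.mem_filter.1 hx).2⟩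
    have : Fintype.card ζ ≤ Fintype.card T := by
      rwa [Fintype.card_coe]
    obtain ⟨e⟩ := Function.Embedding.nonempty_of_card_le this
    refine ⟨p, e.trans (Function.Embedding.subtype _), fun j => ?_⟩
    exact iff_of_eq (hTp _ (e j).2)
  obtain ⟨p, e, he⟩ := h1
  let s' : η → Option ζ := fun x => if h : ∃ j, s x = some (e j) then some h.choose else none
  have hs' : ∀ x j, s' x = some j ↔ s x = some (e j) := by
    intro x j
    simp only [s']
    split_ifs with h
    · have h2 := h.choose_spec
      constructor
      · intro h3
        rw [Option.some.injEq] at h3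
        rw [h2, h3]
      · intro h3
        have h4 := h3.symm.trans h2
        rw [Option.some.injEq] at h4
        rw [Option.some.injEq]
        exact (e.injective h4).symm
    · simp only [reduceCtorEq, false_iff]
      exact fun h' => h ⟨j, h'⟩
  have key : ∀ I : Set ζ, I.Nonempty → ({x | ∃ i ∈ I, s' x = some i} ∈ G ↔ p) := by
    intro I hI
    have hne : (Finset.univ.filter (fun t => t ∈ e '' I)).Nonempty := by
      obtain ⟨i, hi⟩ := hI
      exact ⟨e i, by simp only [Finset.mem_filter, Finset.mem_univ, true_and]; exact ⟨i, hi, rfl⟩⟩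
    set j := (Finset.univ.filter (fun t => t ∈ e '' I)).min' hne with hj
    have hjm := Finset.min'_mem _ hne
    rw [← hj] at hjm
    simp only [Finset.mem_filter, Finset.mem_univ, true_and] at hjm
    have h2 := hc j (e '' I) hjm (fun i hi hi' => by
      have : j ≤ i := Finset.min'_le _ _ (by
        simp only [Finset.mem_filter, Finset.mem_univ, true_and]; exact hi')
      exact absurd hi (not_lt.2 this))
    obtain ⟨j', hj', hj''⟩ := hjm
    rw [← hj'', he j'] at h2
    rw [← h2]
    apply iff_of_eq
    congr 1
    ext x
    simp [hs']
  refine ⟨s', fun j => ?_, ?_⟩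
  · obtain ⟨i, hi⟩ := hs (e j)
    exact ⟨i, (hs' i j).2 hi⟩
  · by_cases hp : p
    · exact Or.inl fun I hI => (key I hI).2 hp
    · exact Or.inr fun I hI h => hp ((key I hI).1 h)

/-- Graham-Rothschild for variable words -/
lemma GR (α ζ : Type) [Finite α] [Nonempty α] [Finite ζ] : ∃ (ι : Type) (_ : Finite ι),
    ∀ G : Set (ι → Option α), ∃ V : Sb ζ α ι,
      (∀ z, (∃ i, z i = none) → up V z ∈ G) ∨ (∀ z, (∃ i, z i = none) → up V z ∉ G) := by
  classical
  obtain ⟨η, f, H⟩ := FU ζ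
  obtain ⟨ι, f', H2⟩ := PA_all (α := α) η Prop inferInstance
  refine ⟨ι, f', fun G => ?_⟩
  obtain ⟨V, hV⟩ := H2 (fun w => w ∈ G)
  let a0 : α := Classical.arbitrary α
  obtain ⟨s, hs, hG⟩ := H {P | up V (fun i => if i ∈ P then none else some a0) ∈ G}
  let U : Sb ζ α η := ⟨fun i => (s i).elim (Sum.inl a0) Sum.inr, fun e => by
    obtain ⟨i, hi⟩ := hs e
    exact ⟨i, by simp [hi]⟩⟩
  have key : ∀ z : ζ → Option α, up (comp V U) z ∈ G ↔
      {x | ∃ i ∈ {j | z j = none}, s x = some i} ∈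
        {P | up V (fun i => if i ∈ P then none else some a0) ∈ G} := by
    intro z
    rw [up_comp]
    apply iff_of_eq
    apply hV
    intro i
    simp only [Set.mem_ofPred_eq, ite_eq_left_iff, reduceCtorEq, imp_false, not_not]
    simp only [U, up, Combinatorics.Subspace.coe_apply]
    cases s i <;> simp
  refine ⟨comp V U, ?_⟩
  rcases hG with hG | hG
  · exact Or.inl fun z hz => (key z).2 (hG _ hz)
  · exact Or.inr fun z hz h => hG _ hz ((key z).1 h)

end SZ

namespace SZ

lemma ev_pi {ι β : Type} [Finite ι] [Finite β] [Nonempty β] (T : Finset ι) (p : β → Prop) :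
    ev (fun z : ι → β => ind (∀ i ∈ T, p (z i))) = (ev fun b => ind (p b)) ^ T.card := by
  classical
  cases nonempty_fintype ι
  cases nonempty_fintype β
  have h1 : ∀ z : ι → β, ind (∀ i ∈ T, p (z i)) = ∏ i, (if i ∈ T then ind (p (z i)) else 1) := by
    intro z
    by_cases h : ∀ i ∈ T, p (z i)
    · rw [ind_true h]
      symm
      apply Finset.prod_eq_one
      intro i _
      split_ifs with hi
      · exact ind_true (h i hi)
      · rfl
    · rw [ind_false h]
      push Not at h
      obtain ⟨i, hi, hp⟩ := h
      symm
      apply Finset.prod_eq_zero (Finset.mem_univ i)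
      rw [if_pos hi, ind_false hp]
  have hb : (Nat.card β : ℝ) ≠ 0 := by exact_mod_cast Nat.card_pos.ne'
  rw [ev_eq]
  simp only [h1]
  have h2 := Finset.prod_univ_sum (fun _ : ι => (Finset.univ : Finset β))
    (fun i b => if i ∈ T then ind (p b) else (1:ℝ))
  rw [Fintype.piFinset_univ] at h2
  rw [← h2, Nat.card_fun, Nat.cast_pow, Nat.card_eq_fintype_card (α := ι), ← Finset.card_univ,
    ← Finset.prod_const, ← Finset.prod_div_distrib]
  have h3 : ∀ i : ι, (∑ b, if i ∈ T then ind (p b) else (1:ℝ)) / (Nat.card β : ℝ) =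
      if i ∈ T then (ev fun b => ind (p b)) else 1 := by
    intro i
    split_ifs
    · rw [ev_eq]
    · simp only [Finset.sum_const, Finset.card_univ, nsmul_eq_mul, mul_one]
      rw [← Nat.card_eq_fintype_card, div_self hb]
  simp only [h3]
  rw [Finset.prod_ite_mem, Finset.univ_inter, Finset.prod_const]

lemma ev_ind_lt_one {β : Type} [Finite β] (p : β → Prop) (h : ∃ b, ¬ p b) :
    ev (fun b => ind (p b)) < 1 := by
  classical
  cases nonempty_fintype β
  obtain ⟨b, hb⟩ := h
  have : Nonempty β := ⟨b⟩
  have hc : 0 < (Nat.card β : ℝ) := by exact_mod_cast Nat.card_pos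
  rw [ev_eq, div_lt_one hc]
  have : ∑ b, ind (p b) < ∑ _b : β, (1:ℝ) :=
    Finset.sum_lt_sum (fun i _ => ind_le_one _) ⟨b, Finset.mem_univ _, by rw [ind_false hb]; norm_num⟩
  simpa using this

lemma bad_small {α : Type} (ι₀ : Type) [Finite ι₀] [Finite α] [Nonempty α] {c : ℝ} (hc : 0 < c) :
    ∃ (ι : Type) (_ : Finite ι), Nonempty (ι₀ → ι) ∧
      ev (fun z : ι → Option α => ind (¬ ∃ p : ι₀ → ι, Function.Injective p ∧ ∀ b, z (p b) ≠ none)) ≤ c := by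
  classical
  cases nonempty_fintype ι₀
  set q := ev (fun b : Option α => ind (b = none)) with hq
  have q0 : 0 ≤ q := ev_nonneg fun _ => ind_nonneg _
  have q1 : q < 1 := ev_ind_lt_one _ ⟨some (Classical.arbitrary α), by simp⟩
  obtain ⟨n, hn⟩ := exists_pow_lt_of_lt_one (show 0 < c / (Fintype.card ι₀ + 1) by positivity) q1
  refine ⟨ι₀ × Fin (n+1), inferInstance, ⟨fun b => (b, 0)⟩, ?_⟩
  let T : ι₀ → Finset (ι₀ × Fin (n+1)) := fun b => Finset.univ.image (fun l => (b, l))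
  have h1 : ∀ z : ι₀ × Fin (n+1) → Option α,
      ind (¬ ∃ p : ι₀ → ι₀ × Fin (n+1), Function.Injective p ∧ ∀ b, z (p b) ≠ none) ≤
        ∑ b, ind (∀ i ∈ T b, z i = none) := by
    intro z
    by_cases h : ∃ b, ∀ i ∈ T b, z i = none
    · obtain ⟨b, hb⟩ := h
      have := Finset.single_le_sum (f := fun b => ind (∀ i ∈ T b, z i = none))
        (fun i _ => ind_nonneg _) (Finset.mem_univ b)
      simp only [ind_true hb] at this
      exact (ind_le_one _).trans this
    · push Not at h
      choose g hg hg' using h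
      rw [ind_false]
      · exact Finset.sum_nonneg fun i _ => ind_nonneg _
      · rw [not_not]
        refine ⟨g, fun b b' hbb => ?_, hg'⟩
        have e1 : ∀ b, (g b).1 = b := by
          intro b
          have := hg b
          simp only [T, Finset.mem_image, Finset.mem_univ, true_and] at this
          obtain ⟨l, hl⟩ := this
          rw [← hl]
        rw [← e1 b, hbb, e1]
  refine (ev_mono h1).trans ?_
  rw [ev_finset_sum]
  have h2 : ∀ b, ev (fun z : ι₀ × Fin (n+1) → Option α => ind (∀ i ∈ T b, z i = none)) = q ^ (n+1) := by
    intro b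
    rw [ev_pi (T b) (fun v : Option α => v = none), ← hq, Finset.card_image_of_injective _ (fun l l' h => by simpa using h)]
    simp
  simp only [h2]
  rw [Finset.sum_const, nsmul_eq_mul, Finset.card_univ]
  have h3 : q ^ (n+1) ≤ c / (Fintype.card ι₀ + 1) :=
    (pow_le_pow_of_le_one q0 q1.le (Nat.le_succ n)).trans hn.le
  have h4 : (0:ℝ) ≤ Fintype.card ι₀ := Nat.cast_nonneg _
  rw [le_div_iff₀ (by linarith)] at h3
  have : 0 ≤ q^(n+1) := by positivity
  nlinarith

/-- insensitivity to exchanging `none` and `some a` -/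
def Ins {α ι : Type} (a : α) (D : Set (ι → Option α)) : Prop :=
  ∀ z z', (∀ i, (z i).getD a = (z' i).getD a) → z ∈ D → z' ∈ D

lemma ins_sub {α μ : Type} [Finite α] [Nonempty α] (h : MD μ α) {c : ℝ} (hc : 0 < c) :
    ∃ (ι : Type) (_ : Finite ι), ∀ (a : α) (D : Set (ι → Option α)), Ins a D →
      c ≤ ev (fun z => ind (z ∈ D)) → ∃ V : Sb μ (Option α) ι, ∀ x, V x ∈ D := by
  classical
  obtain ⟨ι₀, f₀, _, H⟩ := h (c/2) (by linarith)
  obtain ⟨ι, fι, hne, hbad⟩ := bad_small (α := α) ι₀ (c := c/4) (by linarith)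
  refine ⟨ι, fι, fun a D hD hd => ?_⟩
  have hpk : ∀ J : Set ι, ∃ p : ι₀ → ι, (∃ p : ι₀ → ι, Function.Injective p ∧ ∀ b, p b ∈ J) →
      Function.Injective p ∧ ∀ b, p b ∈ J := by
    intro J
    by_cases hJ : ∃ p : ι₀ → ι, Function.Injective p ∧ ∀ b, p b ∈ J
    · obtain ⟨p, hp⟩ := hJ
      exact ⟨p, fun _ => hp⟩
    · exact ⟨hne.some, fun h => absurd h hJ⟩
  choose pk hpk using hpk
  let pt : (ι → Option α) → Set ι := fun z => {i | z i ≠ none}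
  let good : (ι → Option α) → Prop := fun z => ∃ p : ι₀ → ι, Function.Injective p ∧ ∀ b, z (p b) ≠ none
  let P : (ι → Option α) → ι₀ → ι := fun z => pk (pt z)
  have hP : ∀ z, good z → Function.Injective (P z) ∧ ∀ b, z (P z b) ≠ none := fun z hz => hpk (pt z) hz
  let ow : (ι → Option α) → (ι₀ → α) → ι → Option α := fun z x => Function.extend (P z) (fun b => some (x b)) z
  have ow_in : ∀ z x, good z → ∀ b, ow z x (P z b) = some (x b) := fun z x hz b =>
    (hP z hz).1.extend_apply _ _ _
  have ow_out : ∀ z x i, (¬ ∃ b, P z b = i) → ow z x i = z i := fun z x i hi =>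
    Function.extend_apply' _ _ _ hi
  have pt_ow : ∀ z x, good z → pt (ow z x) = pt z := by
    intro z x hz
    ext i
    by_cases hi : ∃ b, P z b = i
    · obtain ⟨b, rfl⟩ := hi
      constructor
      · intro _; exact (hP z hz).2 b
      · intro _
        change ow z x (P z b) ≠ none
        rw [ow_in z x hz]; simp
    · change ow z x i ≠ none ↔ z i ≠ none
      rw [ow_out z x i hi]
  have good_ow : ∀ z x, good z → good (ow z x) := by
    intro z x hz
    refine ⟨P z, (hP z hz).1, fun b => ?_⟩
    rw [ow_in z x hz]; simp
  let Φ : (ι → Option α) × (ι₀ → α) → (ι → Option α) × (ι₀ → α) := fun q =>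
    if good q.1 then (ow q.1 q.2, fun b => (q.1 (P q.1 b)).getD a) else q
  have hΦ : Function.Involutive Φ := by
    rintro ⟨z, x⟩
    by_cases hz : good z
    · have e1 : Φ (z, x) = (ow z x, fun b => (z (P z b)).getD a) := if_pos hz
      have e2 : Φ (ow z x, fun b => (z (P z b)).getD a) = (ow (ow z x) (fun b => (z (P z b)).getD a),
        fun b => (ow z x (P (ow z x) b)).getD a) := if_pos (good_ow z x hz)
      have e3 : P (ow z x) = P z := by simp only [P, pt_ow z x hz]
      rw [e1, e2, e3]
      refine Prod.ext ?_ ?_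
      · ext1 i
        simp only
        by_cases hi : ∃ b, P z b = i
        · obtain ⟨b, rfl⟩ := hi
          have := ow_in (ow z x) (fun b => (z (P z b)).getD a) (good_ow z x hz) b
          rw [e3] at this
          rw [this]
          obtain ⟨v, hv⟩ := Option.ne_none_iff_exists'.1 ((hP z hz).2 b)
          simp [hv]
        · rw [ow_out _ _ i (by rw [e3]; exact hi), ow_out _ _ i hi]
      · ext1 b
        simp only [ow_in z x hz, Option.getD_some]
    · have e1 : Φ (z, x) = (z, x) := if_neg hz
      rw [e1, e1]
  have key := ev_equiv (hΦ.toPerm Φ) (fun q : (ι → Option α) × (ι₀ → α) => ind (good q.1) * ind (q.1 ∈ D))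
  rw [ev_prod, ev_prod] at key
  simp only [ev_const] at key
  have h1 : ∀ z x, ind (good ((hΦ.toPerm Φ) (z, x)).1) * ind (((hΦ.toPerm Φ) (z, x)).1 ∈ D) =
      ind (good z) * ind (ow z x ∈ D) := by
    intro z x
    change ind (good (Φ (z, x)).1) * ind ((Φ (z, x)).1 ∈ D) = _
    by_cases hz : good z
    · have e1 : Φ (z, x) = (ow z x, fun b => (z (P z b)).getD a) := if_pos hz
      rw [e1, ind_true hz, ind_true (good_ow z x hz)]
    · have e1 : Φ (z, x) = (z, x) := if_neg hz
      rw [e1, ind_false hz, zero_mul, zero_mul]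
  simp only [h1, ev_mul] at key
  have h2 : ev (fun z => ind (z ∈ D)) ≤ ev (fun z => ind (good z) * ind (z ∈ D)) + c/4 := by
    refine le_trans ?_ (add_le_add_right hbad _)
    rw [← ev_add]
    apply ev_mono
    intro z
    by_cases hz : good z
    · rw [ind_true hz, one_mul]; linarith [ind_nonneg (¬ good z)]
    · have : ind (¬ good z) = 1 := ind_true hz
      change _ ≤ _ + ind (¬ good z)
      rw [this, ind_false hz]; linarith [ind_le_one (z ∈ D)]
  obtain ⟨z, hz⟩ := exists_ev_le (fun z => ind (good z) * ev (fun x => ind (ow z x ∈ D)))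
  rw [← key] at hz
  have hgz : good z := by
    by_contra hg
    rw [ind_false hg] at hz
    linarith
  rw [ind_true hgz, one_mul] at hz
  obtain ⟨V, hV⟩ := H {x | ow z x ∈ D} (show c/2 ≤ ev (fun x => ind (ow z x ∈ D)) by linarith)
  let V' : Sb μ (Option α) ι := ⟨Function.extend (P z) (fun b => (V.idxFun b).map some id)
    (fun i => Sum.inl (z i)), fun e => by
      obtain ⟨b, hb⟩ := V.proper e
      exact ⟨P z b, by rw [(hP z hgz).1.extend_apply]; simp [hb]⟩⟩
  refine ⟨V', fun w => hD (ow z (V fun j => (w j).getD a)) _ (fun i => ?_) (hV _)⟩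
  by_cases hi : ∃ b, P z b = i
  · obtain ⟨b, rfl⟩ := hi
    rw [ow_in z _ hgz, Combinatorics.Subspace.coe_apply, Combinatorics.Subspace.coe_apply]
    simp only [V']
    rw [(hP z hgz).1.extend_apply]
    cases V.idxFun b <;> simp
  · rw [ow_out z _ i hi, Combinatorics.Subspace.coe_apply]
    simp only [V']
    rw [Function.extend_apply' _ _ _ hi]
    simp

end SZ

namespace SZ

/-- averages over all `μ`-dimensional subspaces are at most `c₀` -/
def BD {β M : Type} (μ : Type) [Finite μ] [Finite β] (f : (M → β) → ℝ) (c₀ : ℝ) : Prop :=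
  ∀ W : Sb μ β M, ev (fun w => f (W w)) ≤ c₀

lemma BD_comp {β M M' μ : Type} [Finite μ] [Finite β] {f : (M → β) → ℝ} {c₀ : ℝ} (h : BD μ f c₀)
    (V : Sb M' β M) : BD μ (fun w => f (V w)) c₀ := by
  intro W
  have := h (comp V W)
  simpa only [comp_apply] using this

lemma Ins_comp {α M M' : Type} {a : α} {D : Set (M → Option α)} (h : Ins a D)
    (V : Sb M' (Option α) M) : Ins a {w | V w ∈ D} := by
  intro z z' hz hzD
  refine h (V z) (V z') (fun i => ?_) hzD
  simp only [Combinatorics.Subspace.coe_apply]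
  cases V.idxFun i with
  | inl b => rfl
  | inr j => exact hz j

lemma Ins_compl {α M : Type} {a : α} {D : Set (M → Option α)} (h : Ins a D) : Ins a {z | z ∉ D} :=
  fun z z' hz hzD hz' => hzD (h z' z (fun i => (hz i).symm) hz')

/-- auxiliary quantitative statement -/
def QQ (α μ : Type) [Finite α] [Finite μ] (c b : ℝ) : Prop :=
  ∀ n : ℕ, ∃ (M : Type) (_ : Finite M), n ≤ Nat.card M ∧ ∀ f : (M → Option α) → ℝ, (∀ z, f z ≤ 1) →
    ∀ c₀ : ℝ, 0 ≤ c₀ → BD μ f c₀ → ∀ (a : α) (D : Set (M → Option α)), Ins a D →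
      ev (fun z => f z * ind (z ∈ D)) ≤
        c₀ * ev (fun z => ind (z ∈ D)) + c + b * ev (fun z => ind (z ∈ D))

lemma QQ_one (α μ : Type) [Finite α] [Finite μ] {c : ℝ} (hc : 0 < c) : QQ α μ c 1 := by
  intro n
  refine ⟨Fin n, inferInstance, by simp, fun f hf c₀ hc₀ _ a D _ => ?_⟩
  have h1 : ev (fun z => f z * ind (z ∈ D)) ≤ ev (fun z => ind (z ∈ D)) := by
    apply ev_mono
    intro z
    have := mul_le_mul_of_nonneg_right (hf z) (ind_nonneg (z ∈ D))
    linarith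
  have h2 : 0 ≤ ev (fun z => ind (z ∈ D)) := ev_nonneg fun _ => ind_nonneg _
  have := mul_nonneg hc₀ h2
  linarith

lemma QQ_step {α μ : Type} [Finite α] [Nonempty α] [Finite μ] (h : MD μ α) {c : ℝ} (hc : 0 < c) :
    ∃ ρ : ℝ, 0 < ρ ∧ ρ ≤ 1 ∧ ∀ b, 0 ≤ b → QQ α μ c b → QQ α μ c ((1 - ρ) * b) := by
  classical
  obtain ⟨ι₁, f₁, H⟩ := ins_sub h (c := c/2) (by linarith)
  set K := Nat.card (Sb μ (Option α) ι₁) with hK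
  set θ : ℝ := (Nat.card (μ → Option α) : ℝ) / (Nat.card (ι₁ → Option α) : ℝ) with hθ
  have θ0 : 0 < θ := by
    have h1 : 0 < Nat.card (μ → Option α) := Nat.card_pos
    have h2 : 0 < Nat.card (ι₁ → Option α) := Nat.card_pos
    positivity
  set r : ℝ := θ * (c/2/(K+1)) with hr
  have r0 : 0 < r := by positivity
  refine ⟨min r 1, lt_min r0 one_pos, min_le_right _ _, fun b hb hQ n => ?_⟩
  obtain ⟨ι₂, f₂, hn, HQ⟩ := hQ n
  refine ⟨ι₁ ⊕ ι₂, inferInstance, ?_, fun f hf c₀ hc₀ hBD a D hD => ?_⟩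
  · rw [Nat.card_sum]; omega
  set d := ev (fun z => ind (z ∈ D)) with hd
  have d0 : 0 ≤ d := ev_nonneg fun _ => ind_nonneg _
  have d1 : d ≤ 1 := ev_le_const zero_le_one fun _ => ind_le_one _
  have hm1 : 0 ≤ 1 - min r 1 := by linarith [min_le_right r 1]
  have hmb : 0 ≤ (1 - min r 1) * b := mul_nonneg hm1 hb
  by_cases hdc : d < c
  · have h1 : ev (fun z => f z * ind (z ∈ D)) ≤ d := by
      apply ev_mono
      intro z
      have := mul_le_mul_of_nonneg_right (hf z) (ind_nonneg (z ∈ D))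
      linarith
    have := mul_nonneg hc₀ d0
    have := mul_nonneg hmb d0
    linarith
  push Not at hdc
  have hd' := hd
  rw [ev_sum, ev_comm] at hd'
  obtain ⟨V, hV⟩ := pick (fun y => ev fun x : ι₁ → Option α => ind (Sum.elim x y ∈ D))
    (fun V : Sb μ (Option α) ι₁ => {y : ι₂ → Option α | ∀ x, Sum.elim (V x) y ∈ D}) (c := c / 2) (by linarith)
    (fun y => ev_le_const zero_le_one fun x => ind_le_one _)
    (fun y hy => by
      refine H a {x | Sum.elim x y ∈ D} ?_ hy
      have := Ins_comp hD (padR y)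
      simpa only [padR_apply] using this) (by linarith)
  rw [← hK] at hV
  set Y := {y : ι₂ → Option α | ∀ x, Sum.elim (V x) y ∈ D} with hY
  have InsY : Ins a Y := by
    intro y y' hyy hy x
    refine hD (Sum.elim (V x) y) _ (fun i => ?_) (hy x)
    rcases i with i | i
    · rfl
    · exact hyy i
  let D' : (ι₁ → Option α) → Set (ι₂ → Option α) := fun x =>
    {y | Sum.elim x y ∈ D ∧ ¬ (x ∈ Set.range (fun w => V w) ∧ y ∈ Y)}
  have InsD' : ∀ x, Ins a (D' x) := by
    intro x y y' hyy hy
    refine ⟨?_, fun h => hy.2 ⟨h.1, InsY y' y (fun i => (hyy i).symm) h.2⟩⟩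
    have := Ins_comp hD (padL x)
    simp only [padL_apply] at this
    exact this y y' hyy hy.1
  have split : ∀ x y, ind (Sum.elim x y ∈ D) =
      ind (y ∈ D' x) + ind (y ∈ Y) * ind (x ∈ Set.range (fun w => V w)) := by
    intro x y
    rw [← ind_and]
    by_cases hR : y ∈ Y ∧ x ∈ Set.range (fun w => V w)
    · have h1 : Sum.elim x y ∈ D := by
        obtain ⟨h1, w, rfl⟩ := hR
        exact h1 w
      have h2 : y ∉ D' x := fun h => h.2 ⟨hR.2, hR.1⟩
      rw [ind_true hR, ind_true h1, ind_false h2, zero_add]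
    · rw [ind_false hR, add_zero]
      apply ind_congr
      exact ⟨fun h => ⟨h, fun h' => hR ⟨h'.2, h'.1⟩⟩, fun h => h.1⟩
  set dD' := ev (fun x => ev (fun y => ind (y ∈ D' x))) with hdD'
  set dY := ev (fun y => ind (y ∈ Y)) with hdY
  have pull : ∀ g : (ι₁ ⊕ ι₂ → Option α) → ℝ,
      ev (fun x => ev (fun y => g (Sum.elim x y) * (ind (y ∈ Y) * ind (x ∈ Set.range (fun w => V w))))) =
      θ * ev (fun y => ind (y ∈ Y) * ev (fun w => g (Sum.elim (V w) y))) := by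
    intro g
    have e1 : ∀ x, ev (fun y => g (Sum.elim x y) * (ind (y ∈ Y) * ind (x ∈ Set.range (fun w => V w)))) =
        ev (fun y => g (Sum.elim x y) * ind (y ∈ Y)) * ind (x ∈ Set.range (fun w => V w)) := by
      intro x
      rw [mul_comm, ← ev_mul]
      congr 1
      ext y
      ring
    simp only [e1]
    rw [ev_range (fun w => V w) (sb_inj V) (fun x => ev (fun y => g (Sum.elim x y) * ind (y ∈ Y))),
      ev_comm]
    congr 2
    ext y
    rw [← ev_mul]
    congr 1
    ext w
    ring
  have hdsum : d = dD' + θ * dY := by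
    rw [hd, ev_sum]
    simp only [split, ev_add]
    congr 1
    have := pull (fun _ => 1)
    simp only [one_mul, ev_const, mul_one] at this
    exact this
  have hfsum : ev (fun z => f z * ind (z ∈ D)) = ev (fun x => ev (fun y => f (Sum.elim x y) * ind (y ∈ D' x))) +
      θ * ev (fun y => ind (y ∈ Y) * ev (fun w => f (Sum.elim (V w) y))) := by
    rw [ev_sum, ← pull f, ← ev_add]
    simp only [split, mul_add, ev_add]
  have b1 : ev (fun y => ind (y ∈ Y) * ev (fun w => f (Sum.elim (V w) y))) ≤ c₀ * dY := by
    rw [hdY, ← ev_mul]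
    apply ev_mono
    intro y
    have := BD_comp hBD (padR y) V
    simp only [padR_apply] at this
    rw [mul_comm]
    exact mul_le_mul_of_nonneg_right this (ind_nonneg _)
  have b2 : ev (fun x => ev (fun y => f (Sum.elim x y) * ind (y ∈ D' x))) ≤ c₀ * dD' + c + b * dD' := by
    have : ∀ x, ev (fun y => f (Sum.elim x y) * ind (y ∈ D' x)) ≤
        c₀ * ev (fun y => ind (y ∈ D' x)) + c + b * ev (fun y => ind (y ∈ D' x)) := by
      intro x
      refine HQ (fun y => f (Sum.elim x y)) (fun y => hf _) c₀ hc₀ ?_ a (D' x) (InsD' x)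
      have := BD_comp hBD (padL x)
      simpa only [padL_apply] using this
    have h2 := ev_mono this
    rw [ev_add, ev_add, ev_mul, ev_mul, ev_const] at h2
    exact h2
  have b3 : r ≤ θ * dY := mul_le_mul_of_nonneg_left hV θ0.le
  have b4 : dD' ≤ (1 - min r 1) * d := by
    have h1 : min r 1 ≤ r := min_le_left _ _
    have h2 : 0 ≤ min r 1 := le_min r0.le zero_le_one
    nlinarith
  have b5 : b * dD' ≤ (1 - min r 1) * b * d := by
    have := mul_le_mul_of_nonneg_left b4 hb
    linarith
  have b6 : θ * ev (fun y => ind (y ∈ Y) * ev (fun w => f (Sum.elim (V w) y))) ≤ θ * (c₀ * dY) :=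
    mul_le_mul_of_nonneg_left b1 θ0.le
  rw [hfsum]
  have : c₀ * d = c₀ * dD' + θ * (c₀ * dY) := by rw [hdsum]; ring
  linarith

lemma T1 {α μ : Type} [Finite α] [Nonempty α] [Finite μ] (h : MD μ α) {c : ℝ} (hc : 0 < c) (n : ℕ) :
    ∃ (M : Type) (_ : Finite M), n ≤ Nat.card M ∧ ∀ f : (M → Option α) → ℝ, (∀ z, f z ≤ 1) →
    ∀ c₀ : ℝ, 0 ≤ c₀ → BD μ f c₀ → ∀ (a : α) (D : Set (M → Option α)), Ins a D →
      ev (fun z => f z * ind (z ∈ D)) ≤ c₀ + c := by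
  obtain ⟨ρ, h0, h1, H⟩ := QQ_step h (c := c/2) (by linarith)
  have hQ : ∀ t : ℕ, QQ α μ (c/2) ((1-ρ)^t) := by
    intro t
    induction t with
    | zero => rw [pow_zero]; exact QQ_one α μ (by linarith)
    | succ t ih =>
      rw [pow_succ']
      exact H _ (pow_nonneg (by linarith) t) ih
  obtain ⟨t, ht⟩ := exists_pow_lt_of_lt_one (show 0 < c/2 by linarith) (show 1 - ρ < 1 by linarith)
  obtain ⟨M, fM, hM, HM⟩ := hQ t n
  refine ⟨M, fM, hM, fun f hf c₀ hc₀ hBD a D hD => ?_⟩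
  have h2 := HM f hf c₀ hc₀ hBD a D hD
  have d0 : 0 ≤ ev (fun z => ind (z ∈ D)) := ev_nonneg fun _ => ind_nonneg _
  have d1 : ev (fun z => ind (z ∈ D)) ≤ 1 := ev_le_const zero_le_one fun _ => ind_le_one _
  have p0 : 0 ≤ (1-ρ)^t := pow_nonneg (by linarith) t
  nlinarith

lemma TS {α : Type} [Finite α] [Nonempty α] (h : MD Unit α) (S : Finset α) :
    ∀ (μ : Type) (_ : Finite μ) (c : ℝ) (_ : 0 < c) (n : ℕ),
    ∃ (M : Type) (_ : Finite M), n ≤ Nat.card M ∧ ∀ f : (M → Option α) → ℝ, (∀ z, f z ≤ 1) →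
    ∀ c₀ : ℝ, 0 ≤ c₀ → BD μ f c₀ → ∀ (D : α → Set (M → Option α)), (∀ a ∈ S, Ins a (D a)) →
      ev (fun z => f z * ind (∀ a ∈ S, z ∈ D a)) ≤ c₀ + c := by
  classical
  induction S using Finset.induction_on with
  | empty =>
    intro μ _ c hc n
    refine ⟨μ ⊕ Fin n, inferInstance, by simp, fun f hf c₀ hc₀ hBD D _ => ?_⟩
    have : ∀ z : μ ⊕ Fin n → Option α, f z * ind (∀ a ∈ (∅ : Finset α), z ∈ D a) = f z := by
      intro z
      rw [ind_true (by simp), mul_one]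
    simp only [this]
    rw [ev_sum, ev_comm]
    refine ev_le_const (by linarith) fun y => ?_
    have := hBD (padR y)
    simp only [padR_apply] at this
    linarith
  | insert a S ha ih =>
    intro μ _ c hc n
    obtain ⟨M₁, f₁, _, H1⟩ := T1 (MD_all h μ) (c := c/2) (by linarith) 0
    obtain ⟨M, fM, hn, H⟩ := ih M₁ f₁ (c/2) (by linarith) n
    refine ⟨M, fM, hn, fun f hf c₀ hc₀ hBD D hD => ?_⟩
    have h1 := H (fun z => f z * ind (z ∈ D a)) (fun z => by
        by_cases hz : z ∈ D a
        · rw [ind_true hz, mul_one]; exact hf z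
        · rw [ind_false hz, mul_zero]; exact zero_le_one) (c₀ + c/2) (by linarith) (fun W =>
          H1 (fun w => f (W w)) (fun w => hf _) c₀ hc₀ (BD_comp hBD W) a {w | W w ∈ D a}
            (Ins_comp (hD a (Finset.mem_insert_self _ _)) W))
        D (fun b hb => hD b (Finset.mem_insert_of_mem hb))
    have h2 : ∀ z, f z * ind (∀ b ∈ insert a S, z ∈ D b) =
        f z * ind (z ∈ D a) * ind (∀ b ∈ S, z ∈ D b) := by
      intro z
      rw [mul_assoc, ← ind_and]
      congr 1
      apply ind_congr
      simp
    simp only [h2]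
    linarith

end SZ

namespace SZ

/-- no combinatorial line inside `A` -/
def LF {β ι : Type} (A : Set (ι → β)) : Prop := ¬ ∃ l : Sb Unit β ι, ∀ x, l x ∈ A

lemma LF_comp {β ι μ : Type} {A : Set (ι → β)} (h : LF A) (V : Sb μ β ι) : LF {w | V w ∈ A} := by
  rintro ⟨l, hl⟩
  exact h ⟨comp V l, fun x => by rw [comp_apply]; exact hl x⟩

/-- the critical density -/
lemma crit {β : Type} [Finite β] [Nonempty β] (h : ¬ MD Unit β) : ∃ lam : ℝ, 0 < lam ∧ lam ≤ 1 ∧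
    (∀ ε : ℝ, 0 < ε → ∃ (ι : Type) (_ : Finite ι), ∀ A : Set (ι → β), LF A →
      ev (fun x => ind (x ∈ A)) ≤ lam + ε) ∧
    (∀ (ι : Type) [Finite ι], ∃ A : Set (ι → β), LF A ∧ lam ≤ ev (fun x => ind (x ∈ A))) := by
  classical
  set P : Set ℝ := {d | 0 ≤ d ∧ ∃ (ι : Type) (_ : Finite ι), ∀ A : Set (ι → β), LF A →
      ev (fun x => ind (x ∈ A)) ≤ d} with hP
  have h1 : (1:ℝ) ∈ P := ⟨zero_le_one, Unit, inferInstance, fun A _ =>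
    ev_le_const zero_le_one fun _ => ind_le_one _⟩
  have hbdd : BddBelow P := ⟨0, fun d hd => hd.1⟩
  unfold MD at h
  push Not at h
  obtain ⟨δ, hδ, H⟩ := h
  refine ⟨sInf P, ?_, csInf_le hbdd h1, ?_, ?_⟩
  · refine lt_of_lt_of_le hδ (le_csInf ⟨1, h1⟩ ?_)
    rintro d ⟨hd, ι, _, hι⟩
    obtain ⟨A, hA, hl⟩ := H ι inferInstance inferInstance
    refine hA.trans (hι A ?_)
    rintro ⟨l, hh⟩
    obtain ⟨x, hx⟩ := hl l
    exact hx (hh x)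
  · intro ε hε
    obtain ⟨d, ⟨hd, ι, fι, hι⟩, hlt⟩ := exists_lt_of_csInf_lt ⟨1, h1⟩ (show sInf P < sInf P + ε by linarith)
    exact ⟨ι, fι, fun A hA => (hι A hA).trans hlt.le⟩
  · intro ι _
    have : Nonempty {A : Set (ι → β) // LF A} := ⟨⟨∅, by
      rintro ⟨l, hl⟩
      obtain ⟨b⟩ := ‹Nonempty β›
      exact (hl fun _ => b)⟩⟩
    obtain ⟨⟨A, hA⟩, hmax⟩ := Finite.exists_max
      (fun A : {A : Set (ι → β) // LF A} => ev (fun x => ind (x ∈ A.1)))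
    refine ⟨A, hA, csInf_le hbdd ⟨ev_nonneg fun _ => ind_nonneg _, ι, inferInstance, fun B hB => hmax ⟨B, hB⟩⟩⟩

/-- bound for the complement of an intersection of insensitive sets -/
lemma compl_bound {α M : Type} [Finite α] [Finite M] {c : ℝ} (f : (M → Option α) → ℝ)
    (H : ∀ (D : α → Set (M → Option α)), (∀ a, Ins a (D a)) →
      ev (fun z => f z * ind (∀ a, z ∈ D a)) ≤ c)
    (C : α → Set (M → Option α)) (hC : ∀ a, Ins a (C a)) (S : Finset α) :
    ev (fun z => f z * (1 - ind (∀ a ∈ S, z ∈ C a))) ≤ S.card * c := by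
  classical
  induction S using Finset.induction_on with
  | empty =>
    refine le_of_eq ?_
    have : ∀ z : M → Option α, f z * (1 - ind (∀ a ∈ (∅ : Finset α), z ∈ C a)) = 0 := by
      intro z
      rw [ind_true (by simp)]; ring
    simp only [this]
    rw [ev_const]; simp
  | insert a S ha ih =>
    have h1 := H (fun b => if b = a then {z | z ∉ C a} else if b ∈ S then C b else Set.univ) (by
      intro b
      by_cases hb : b = a
      · subst hb
        simpa using Ins_compl (hC b)
      · by_cases hs : b ∈ S
        · simpa [hb, hs] using hC b
        · simp only [hb, hs, if_false]
          intro z z' _ _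
          trivial)
    have h2 : ∀ z, f z * (1 - ind (∀ b ∈ insert a S, z ∈ C b)) =
        f z * (1 - ind (∀ b ∈ S, z ∈ C b)) +
        f z * ind (∀ b, z ∈ (if b = a then {z | z ∉ C a} else if b ∈ S then C b else Set.univ)) := by
      intro z
      rw [← mul_add]
      congr 1
      have e1 : ind (∀ b ∈ insert a S, z ∈ C b) = ind (z ∈ C a) * ind (∀ b ∈ S, z ∈ C b) := by
        rw [← ind_and]; apply ind_congr; simp
      have e2 : ind (∀ b, z ∈ (if b = a then {z | z ∉ C a} else if b ∈ S then C b else Set.univ)) =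
          (1 - ind (z ∈ C a)) * ind (∀ b ∈ S, z ∈ C b) := by
        rw [← ind_not, ← ind_and]; apply ind_congr
        constructor
        · intro h
          refine ⟨by simpa using h a, fun b hb => ?_⟩
          have hne : b ≠ a := fun e => ha (e ▸ hb)
          simpa [hne, hb] using h b
        · rintro ⟨h, h'⟩ b
          by_cases hb : b = a
          · subst hb; simpa using h
          · by_cases hs : b ∈ S
            · simpa [hb, hs] using h' b hs
            · simp [hb, hs]
      rw [e1, e2]; ring
    simp only [h2]
    rw [ev_add, Finset.card_insert_of_notMem ha]
    push_cast
    linarith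

/-- wildcards of a line over `α` become `none` -/
lemma line_word {α ι : Type} [Nonempty α] (l : Sb Unit α ι) : ∃ z : ι → Option α, (∃ i, z i = none) ∧
    ∀ a i, (z i).getD a = l (fun _ => a) i := by
  refine ⟨up l (fun _ => none), up_none l _ ⟨(), rfl⟩, fun a i => ?_⟩
  rw [up_getD]; rfl

/-- a word containing `none` is a line over `Option α` -/
lemma word_line {α ι : Type} (z : ι → Option α) (hz : ∃ i, z i = none) : ∃ l : Sb Unit (Option α) ι,
    ∀ x : Unit → Option α, (x () = none ∧ l x = z) ∨ ∃ a, x () = some a ∧ l x = fun i => some ((z i).getD a) := by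
  classical
  refine ⟨⟨fun i => match z i with | none => Sum.inr () | some a => Sum.inl (some a), fun _ => ?_⟩, fun x => ?_⟩
  · obtain ⟨i, hi⟩ := hz
    exact ⟨i, by simp [hi]⟩
  · cases hx : x () with
    | none =>
      left
      refine ⟨rfl, ?_⟩
      ext1 i
      rw [Combinatorics.Subspace.coe_apply]
      cases hi : z i <;> simp [hi, hx]
    | some a =>
      right
      refine ⟨a, rfl, ?_⟩
      ext1 i
      rw [Combinatorics.Subspace.coe_apply]
      cases hi : z i <;> simp [hi, hx]

/-- embedding a small cube into a larger one -/
lemma embS {α ι₀ M : Type} [Nonempty α] (e : ι₀ ↪ M) : Nonempty (Sb ι₀ α M) := by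
  classical
  obtain ⟨a⟩ := ‹Nonempty α›
  refine ⟨⟨fun i => if h : ∃ j, e j = i then Sum.inr h.choose else Sum.inl a, fun j => ⟨e j, ?_⟩⟩⟩
  have h : ∃ j', e j' = e j := ⟨j, rfl⟩
  rw [dif_pos h]
  exact congrArg Sum.inr (e.injective h.choose_spec)

end SZ

namespace SZ

lemma good {α ι₀ ι₁ ι₂ M : Type} [Finite α] [Nonempty α] [Finite ι₀] [Finite ι₁] [Finite ι₂] {c : ℝ}
    (hc : 0 < c) (H : ∀ B : Set (ι₀ → α), c ≤ ev (fun x => ind (x ∈ B)) → ∃ V : Sb Unit α ι₀, ∀ x, V x ∈ B)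
    (A : Set (ι₁ ⊕ ι₂ → Option α)) (V : Sb M α ι₁) (U : Sb ι₀ α M)
    (hA : ∀ x : ι₁ → Option α, 2 * c ≤ ev (fun y : ι₂ → Option α => ind (Sum.elim x y ∈ A))) :
    ∃ z : M → Option α, (∃ i, z i = none) ∧ c / (Nat.card (Sb Unit α ι₀) + 1) ≤
      ev (fun y : ι₂ → Option α => ind (∀ a, Sum.elim (fun i => some ((up V z i).getD a)) y ∈ A)) := by
  obtain ⟨l, hl⟩ := pick (I := Sb Unit α ι₀)
    (fun y : ι₂ → Option α => ev (fun x : ι₀ → α => ind (Sum.elim (fun i => some (V (U x) i)) y ∈ A)))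
    (fun l => {y | ∀ x : Unit → α, Sum.elim (fun i => some (V (U (l x)) i)) y ∈ A}) hc
    (fun y => ev_le_const zero_le_one fun _ => ind_le_one _)
    (fun y hy => H {x | Sum.elim (fun i => some (V (U x) i)) y ∈ A} hy)
    (by
      rw [ev_comm]
      exact const_le_ev fun x => hA _)
  refine ⟨up U (up l fun _ => none), up_none U _ (up_none l _ ⟨(), rfl⟩), hl.trans ?_⟩
  refine ev_mono fun y => ind_mono fun h a => ?_
  have := h fun _ => a
  convert this using 4 with i
  rw [up_getD]
  have e : (fun j => (up U (up l fun _ => none) j).getD a) = U (l fun _ => a) := by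
    ext j
    rw [up_getD]
    congr 1
    ext j
    rw [up_getD]
    rfl
  rw [e]

theorem main_step {α : Type} [Finite α] [Nonempty α] (h : MD Unit α) : MD Unit (Option α) := by
  classical
  cases nonempty_fintype α
  by_contra hcon
  obtain ⟨lam, l0, l1, Hup, Hlow⟩ := crit hcon
  obtain ⟨ι₀, f₀, f₀', H₀⟩ := h (lam / 4) (by linarith)
  set K : ℝ := (Nat.card (Sb Unit α ι₀) : ℝ)
  have hK : 0 ≤ K := Nat.cast_nonneg _
  set Θ : ℝ := lam / 4 / (K + 1) with hΘ
  have Θ0 : 0 < Θ := by positivity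
  have Θ1 : Θ ≤ 1 := by
    rw [hΘ, div_le_one (by linarith)]; linarith
  set t : ℝ := lam * Θ / 16 with ht
  have t0 : 0 < t := by positivity
  have tl : t ≤ lam / 16 := by nlinarith
  set k : ℝ := (Fintype.card α : ℝ) with hk
  have k0 : 0 ≤ k := Nat.cast_nonneg _
  obtain ⟨μ, fμ, Hμ⟩ := Hup t t0
  set q : ℝ := ev (fun b : Option α => ind (b ≠ none)) with hq
  have q0 : 0 ≤ q := ev_nonneg fun _ => ind_nonneg _
  have q1 : q < 1 := ev_ind_lt_one _ ⟨none, by simp⟩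
  obtain ⟨n, hn⟩ := exists_pow_lt_of_lt_one t0 q1
  obtain ⟨M, fM, hM, HM⟩ := TS h Finset.univ μ fμ (t / (k + 1)) (by positivity) (n + Nat.card ι₀)
  cases nonempty_fintype M
  cases nonempty_fintype ι₀
  have hκ : ev (fun z : M → Option α => ind (∀ i, z i ≠ none)) ≤ t := by
    have := ev_pi (Finset.univ : Finset M) (fun b : Option α => b ≠ none)
    simp only [Finset.mem_univ, true_imp_iff] at this
    rw [this, ← hq]
    refine le_trans (pow_le_pow_of_le_one q0 q1.le ?_) hn.le
    rw [Finset.card_univ, ← Nat.card_eq_fintype_card]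
    omega
  obtain ⟨e⟩ : Nonempty (ι₀ ↪ M) := by
    apply Function.Embedding.nonempty_of_card_le
    rw [← Nat.card_eq_fintype_card, ← Nat.card_eq_fintype_card]
    omega
  obtain ⟨U⟩ := embS (α := α) e
  obtain ⟨ι₁, f₁, HG⟩ := GR α M
  have hc1 : (0:ℝ) < Nat.card (ι₁ → Option α) := by
    exact_mod_cast Nat.card_pos
  obtain ⟨ι₂, f₂, H₂⟩ := Hup (t / Nat.card (ι₁ → Option α)) (by positivity)
  obtain ⟨A, hLF, hA⟩ := Hlow (ι₁ ⊕ ι₂)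
  have hfib : ∀ x : ι₁ → Option α, lam - t ≤ ev (fun y : ι₂ → Option α => ind (Sum.elim x y ∈ A)) := by
    intro x
    rw [ev_sum] at hA
    have := ev_all_ge (le_of_lt (show 0 < t / (Nat.card (ι₁ → Option α)) by positivity)) hA (fun x => by
      have := H₂ _ (LF_comp hLF (padL x))
      simpa only [Set.mem_ofPred_eq, padL_apply] using this) x
    rwa [mul_div_cancel₀ _ hc1.ne'] at this
  obtain ⟨V, hV⟩ := HG {w | Θ ≤ ev (fun y : ι₂ → Option α =>
    ind (∀ a, Sum.elim (fun i => some ((w i).getD a)) y ∈ A))}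
  have hV' : ∀ z : M → Option α, (∃ i, z i = none) → Θ ≤ ev (fun y : ι₂ → Option α =>
    ind (∀ a, Sum.elim (fun i => some ((up V z i).getD a)) y ∈ A)) := by
    rcases hV with hV | hV
    · exact hV
    · exfalso
      obtain ⟨z, hz, hz'⟩ := good (by linarith) H₀ A V U (fun x => le_trans (by linarith) (hfib x))
      exact hV z hz hz'
  -- indicator functions
  set X : (M → Option α) → (ι₂ → Option α) → ℝ := fun z y => ind (Sum.elim (up V z) y ∈ A) with hX
  set C : (ι₂ → Option α) → α → Set (M → Option α) :=
    fun y a => {z | Sum.elim (fun i => some ((up V z i).getD a)) y ∈ A} with hC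
  set Y : (M → Option α) → (ι₂ → Option α) → ℝ := fun z y => ind (∀ a, z ∈ C y a) with hY
  have hIns : ∀ y a, Ins a (C y a) := by
    intro y a z z' hz hzC
    simp only [hC, Set.mem_ofPred_eq, up_getD] at hzC ⊢
    simpa only [hz] using hzC
  have hXY : ∀ z y, X z y * Y z y ≤ ind (∀ i, z i ≠ none) := by
    intro z y
    by_cases hz : ∀ i, z i ≠ none
    · rw [ind_true hz]
      exact mul_le_one₀ (ind_le_one _) (ind_nonneg _) (ind_le_one _)
    · rw [ind_false hz, hX, hY]
      dsimp only
      rw [← ind_and]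
      refine le_of_eq (ind_false ?_)
      rintro ⟨h1, h2⟩
      push Not at hz
      obtain ⟨l, hl⟩ := word_line _ (up_none V z hz)
      refine LF_comp hLF (padR y) ⟨l, fun x => ?_⟩
      simp only [Set.mem_ofPred_eq, padR_apply]
      rcases hl x with ⟨_, e⟩ | ⟨a, _, e⟩
      · rw [e]; exact h1
      · rw [e]; exact h2 a
  have hYlow : ∀ z, Θ * (1 - ind (∀ i, z i ≠ none)) ≤ ev (fun y => Y z y) := by
    intro z
    by_cases hz : ∀ i, z i ≠ none
    · rw [ind_true hz, sub_self, mul_zero]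
      exact ev_nonneg fun _ => ind_nonneg _
    · rw [ind_false hz, sub_zero, mul_one]
      push Not at hz
      exact hV' z hz
  set κ : ℝ := ev (fun z : M → Option α => ind (∀ i, z i ≠ none)) with hκd
  have κ0 : 0 ≤ κ := ev_nonneg fun _ => ind_nonneg _
  have E1 : lam - t ≤ ev (fun z => ev (fun y => X z y)) := const_le_ev fun z => hfib _
  have E2 : Θ * (1 - κ) ≤ ev (fun z => ev (fun y => Y z y)) := by
    have := ev_mono hYlow
    rwa [ev_mul, ev_sub, ev_const] at this
  have E3 : ev (fun z => ev (fun y => X z y * Y z y)) ≤ κ := by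
    refine ev_mono fun z => ev_le_const (ind_nonneg _) fun y => hXY z y
  have E4 : ∀ y, ev (fun z => (X z y - (lam + t)) * (1 - Y z y)) ≤ k * (t / (k + 1)) := by
    intro y
    have := compl_bound (c := t / (k+1)) (fun z => X z y - (lam + t)) (fun D hD => by
      have := HM (fun z => X z y - (lam + t)) (fun z => by
          have : X z y ≤ 1 := ind_le_one _
          linarith) 0 le_rfl (fun W => by
          have := Hμ _ (LF_comp hLF (comp (padR y) (comp (up V) W)))
          rw [ev_sub, ev_const]
          simp only [Set.mem_ofPred_eq, comp_apply, padR_apply] at this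
          linarith) D (fun a _ => hD a)
      simpa using this) (C y) (hIns y) Finset.univ
    simpa using this
  have E5 : ev (fun z => ev (fun y => (X z y - (lam + t)) * (1 - Y z y))) ≤ k * (t / (k + 1)) := by
    rw [ev_comm]
    exact ev_le_const (by positivity) E4
  have E6 : ev (fun z => ev (fun y => (X z y - (lam + t)) * (1 - Y z y))) =
      ev (fun z => ev (fun y => X z y)) - ev (fun z => ev (fun y => X z y * Y z y)) - (lam + t)
       + (lam + t) * ev (fun z => ev (fun y => Y z y)) := by
    have : ∀ z y, (X z y - (lam + t)) * (1 - Y z y) =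
      X z y - X z y * Y z y - (lam + t) + (lam + t) * Y z y := by intro z y; ring
    simp only [this, ev_add, ev_sub, ev_mul, ev_const]
  have E7 : k * (t / (k + 1)) ≤ t := by
    rw [mul_div_assoc', div_le_iff₀ (by linarith)]; nlinarith
  have E8 : lam * (Θ * (1 - κ)) ≤ (lam + t) * ev (fun z => ev (fun y => Y z y)) := by
    refine mul_le_mul (by linarith) E2 (mul_nonneg Θ0.le (by linarith)) (by linarith)
  have E9 : lam * (Θ * (1 - κ)) = 16 * t * (1 - κ) := by rw [ht]; ring
  have : t * κ ≤ t * (1/16) := mul_le_mul_of_nonneg_left (by linarith) t0.le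
  nlinarith

theorem DHJ (α : Type) [Finite α] : MD Unit α := by
  induction α using Finite.induction_empty_option with
  | of_equiv e ih =>
    rename_i α β
    intro δ hδ
    obtain ⟨ι, fι, fι', H⟩ := ih δ hδ
    have : Finite (ι → β) := Finite.of_equiv _ (Equiv.arrowCongr (Equiv.refl ι) e)
    refine ⟨ι, fι, this, fun A hA => ?_⟩
    obtain ⟨V, hV⟩ := H {x | (fun i => e (x i)) ∈ A} (by
      rw [ev_equiv (Equiv.arrowCongr (Equiv.refl ι) e)] at hA
      exact hA)
    refine ⟨⟨fun i => (V.idxFun i).map e id, fun u => ?_⟩, fun x => ?_⟩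
    · obtain ⟨i, hi⟩ := V.proper u
      exact ⟨i, by simp [hi]⟩
    · have := hV (fun u => e.symm (x u))
      simp only [Set.mem_ofPred_eq] at this
      convert this using 1
      ext i
      simp only [Combinatorics.Subspace.coe_apply]
      cases V.idxFun i <;> simp
  | h_empty =>
    intro δ hδ
    refine ⟨Unit, inferInstance, inferInstance, fun A hA => ⟨⟨Sum.inr, fun u => ⟨u, rfl⟩⟩, fun x => (x ()).elim⟩⟩
  | h_option ih =>
    rename_i α _
    rcases isEmpty_or_nonempty α with hα | hα
    · intro δ hδ
      refine ⟨Unit, inferInstance, inferInstance, fun A hA => ⟨⟨Sum.inr, fun u => ⟨u, rfl⟩⟩, fun x => ?_⟩⟩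
      obtain ⟨y, hy⟩ := exists_ev_le (fun x : Unit → Option α => ind (x ∈ A))
      have hyA : y ∈ A := by
        by_contra hn
        rw [ind_false hn] at hy
        linarith
      convert hyA using 1
      exact Subsingleton.elim _ _
    · exact main_step ih

end SZ

namespace SZ

lemma count_shift (N L s : ℕ) (hL : L ≤ N) (hs : s ≤ L) (A : Finset ℕ) (hA : A ⊆ Finset.Icc 1 N) :
    A.card ≤ (Finset.univ.filter (fun v : Fin (N - L) => 1 + (v : ℕ) + s ∈ A)).card + L := by
  classical
  have h : A ⊆ (Finset.univ.filter (fun v : Fin (N - L) => 1 + (v : ℕ) + s ∈ A)).image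
      (fun v : Fin (N - L) => 1 + (v : ℕ) + s) ∪ (Finset.Ioc 0 s ∪ Finset.Ioc (N - L + s) N) := by
    intro a ha
    have h1 := Finset.mem_Icc.1 (hA ha)
    simp only [Finset.mem_union, Finset.mem_image, Finset.mem_filter, Finset.mem_univ, true_and,
      Finset.mem_Ioc]
    by_cases c1 : a ≤ s
    · right; left; omega
    · by_cases c2 : N - L + s < a
      · right; right; omega
      · left
        have e : 1 + (a - s - 1) + s = a := by omega
        exact ⟨⟨a - s - 1, by omega⟩, by simpa [e] using ha, by simpa using e⟩
  refine (Finset.card_le_card h).trans ((Finset.card_union_le _ _).trans ?_)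
  refine add_le_add Finset.card_image_le ((Finset.card_union_le _ _).trans ?_)
  simp only [Nat.card_Ioc]
  omega

lemma line_sum {ℓ : ℕ} {ι : Type} [Fintype ι] (l : Sb Unit (Fin ℓ) ι) : ∃ c d : ℕ, 1 ≤ d ∧
    ∀ j : Fin ℓ, ∑ i, ((l (fun _ => j) i : Fin ℓ) : ℕ) = c + j * d := by
  classical
  refine ⟨∑ i, (l.idxFun i).elim (fun a : Fin ℓ => (a : ℕ)) (fun _ => 0),
    ∑ i, (l.idxFun i).elim (fun _ => 0) (fun _ => 1), ?_, fun j => ?_⟩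
  · obtain ⟨i, hi⟩ := l.proper ()
    have := Finset.single_le_sum (f := fun i => (l.idxFun i).elim (fun _ => 0) (fun _ => 1))
      (fun i _ => Nat.zero_le _) (Finset.mem_univ i)
    simpa [hi] using this
  · rw [Finset.mul_sum, ← Finset.sum_add_distrib]
    refine Finset.sum_congr rfl fun i _ => ?_
    rw [Combinatorics.Subspace.coe_apply]
    cases l.idxFun i <;> simp

end SZ

theorem szemeredi (δ : ℝ) (hδ : 0 < δ) (ℓ : ℕ) (hℓ : 3 ≤ ℓ) :
    ∃ N₀ : ℕ, ∀ N : ℕ, N₀ ≤ N → ∀ A : Finset ℕ, A ⊆ Finset.Icc 1 N →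
      δ * N ≤ A.card → ∃ a d : ℕ, 1 ≤ d ∧ ∀ i : ℕ, i < ℓ → a + i * d ∈ A := by
  classical
  obtain ⟨ι, fι, fι', H⟩ := SZ.DHJ (Fin ℓ) (δ / 2) (by linarith)
  cases nonempty_fintype ι
  have : Nonempty (Fin ℓ) := ⟨⟨0, by omega⟩⟩
  set L := Fintype.card ι * ℓ with hL
  obtain ⟨m, hm⟩ := exists_nat_gt (2 * L / δ)
  refine ⟨m + L + 1, fun N hN A hA hd => ?_⟩
  have hpos : 0 < N - L := by omega
  have : Nonempty (Fin (N - L)) := ⟨⟨0, hpos⟩⟩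
  have key : ∀ x : ι → Fin ℓ, δ / 2 ≤
      SZ.ev (fun v : Fin (N - L) => SZ.ind (1 + (v : ℕ) + ∑ i, (x i : ℕ) ∈ A)) := by
    intro x
    have hs : ∑ i, (x i : ℕ) ≤ L := by
      rw [hL]
      refine (Finset.sum_le_card_nsmul _ _ ℓ fun i _ => (x i).2.le).trans ?_
      simp
    have h1 := SZ.count_shift N L _ (by omega) hs A hA
    rw [SZ.ev_eq]
    have e : ∑ v : Fin (N - L), SZ.ind (1 + (v : ℕ) + ∑ i, (x i : ℕ) ∈ A) =
        ((Finset.univ.filter (fun v : Fin (N - L) => 1 + (v : ℕ) + ∑ i, (x i : ℕ) ∈ A)).card : ℝ) := by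
      rw [Finset.card_filter]
      push_cast
      refine Finset.sum_congr rfl fun v _ => ?_
      split_ifs with hv
      · exact SZ.ind_true hv
      · exact SZ.ind_false hv
    rw [e, Nat.card_eq_fintype_card, Fintype.card_fin, le_div_iff₀ (by exact_mod_cast hpos)]
    rw [Nat.cast_sub (by omega)]
    have h1' := (Nat.cast_le (α := ℝ)).2 h1
    rw [Nat.cast_add] at h1'
    have h3 : (m : ℝ) ≤ N := by exact_mod_cast (by omega : m ≤ N)
    rw [div_lt_iff₀ hδ] at hm
    have h4 : (m : ℝ) * δ ≤ N * δ := mul_le_mul_of_nonneg_right h3 hδ.le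
    have h5 : 0 ≤ δ / 2 * (L : ℝ) := by positivity
    have h6 : δ / 2 * ((N : ℝ) - L) = δ * N - N * δ / 2 - δ / 2 * L := by ring
    rw [h6]
    linarith
  have hE := SZ.const_le_ev key
  rw [SZ.ev_comm] at hE
  obtain ⟨v, hv⟩ := SZ.exists_ev_le (fun v : Fin (N - L) =>
    SZ.ev (fun x : ι → Fin ℓ => SZ.ind (1 + (v : ℕ) + ∑ i, (x i : ℕ) ∈ A)))
  obtain ⟨l, hl⟩ := H {x | 1 + (v : ℕ) + ∑ i, (x i : ℕ) ∈ A} (hE.trans hv)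
  obtain ⟨c, d, hd1, hsum⟩ := SZ.line_sum l
  refine ⟨1 + v + c, d, hd1, fun i hi => ?_⟩
  have h1 := hl (fun _ => ⟨i, hi⟩)
  simp only [Set.mem_ofPred_eq] at h1
  rw [hsum ⟨i, hi⟩] at h1
  simpa [add_assoc] using h1
end

section
/- For any constant δ > 0, there exists N₀ such that for all integers N ≥ N₀ one has Q(N) < δ·N, where Q(N) denotes the maximum number of perfect squares contained in an arithmetic progression of length N. -/
open scoped Classical in
/-- The number of indices `n ∈ {0, …, N-1}` such that `a + n * d` is an integer square. -/
noncomputable def squaresInAP (N : ℕ) (a d : ℤ) : ℕ :=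
  ((Finset.range N).filter fun n => ∃ m : ℤ, a + (n : ℤ) * d = m ^ 2).card

section

/-- The curve `y² = x (x - e) (x - f)` over `ℚ`. -/
def EC (e f : ℤ) : WeierstrassCurve ℚ := ⟨0, -((e : ℚ) + f), 0, (e : ℚ) * f, 0⟩

/-- Nondegeneracy of the parameters. -/
def Good (e f : ℤ) : Prop := e ≠ 0 ∧ f ≠ 0 ∧ e ≠ f

/-- Rational points. -/
abbrev Pt (e f : ℤ) : Type := (EC e f).toAffine.Point

open WeierstrassCurve WeierstrassCurve.Affine

lemma ec_delta {e f : ℤ} (h : Good e f) : (EC e f).Δ ≠ 0 := by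
  obtain ⟨h1, h2, h3⟩ := h
  have : (EC e f).Δ = 16 * (e : ℚ) ^ 2 * (f : ℚ) ^ 2 * ((e : ℚ) - f) ^ 2 := by
    simp only [EC, WeierstrassCurve.Δ, WeierstrassCurve.b₂, WeierstrassCurve.b₄,
      WeierstrassCurve.b₆, WeierstrassCurve.b₈]
    ring
  rw [this]
  have : (e : ℚ) - f ≠ 0 := sub_ne_zero.mpr (by exact_mod_cast h3)
  have : (e : ℚ) ≠ 0 := by exact_mod_cast h1
  have : (f : ℚ) ≠ 0 := by exact_mod_cast h2
  positivity

lemma ec_elliptic {e f : ℤ} (h : Good e f) : (EC e f).IsElliptic :=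
  ⟨isUnit_iff_ne_zero.mpr (ec_delta h)⟩

lemma ec_eqn {e f : ℤ} {x y : ℚ} :
    (EC e f).toAffine.Equation x y ↔ y ^ 2 = x * (x - e) * (x - f) := by
  rw [WeierstrassCurve.Affine.equation_iff]
  simp only [EC]
  constructor <;> intro h <;> linear_combination h

lemma ec_ns {e f : ℤ} (h : Good e f) {x y : ℚ} (hxy : y ^ 2 = x * (x - e) * (x - f)) :
    (EC e f).toAffine.Nonsingular x y :=
  (WeierstrassCurve.Affine.equation_iff_nonsingular_of_Δ_ne_zero (ec_delta h)).mp
    (ec_eqn.mpr hxy)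

lemma ec_of_ns {e f : ℤ} {x y : ℚ} (h : (EC e f).toAffine.Nonsingular x y) :
    y ^ 2 = x * (x - e) * (x - f) := ec_eqn.mp h.1

lemma ec_some_congr {e f : ℤ} {x y x' y' : ℚ} (h : (EC e f).toAffine.Nonsingular x y)
    (hx : x = x') (hy : y = y') :
    ∃ h' : (EC e f).toAffine.Nonsingular x' y', (Point.some x y h : Pt e f) = Point.some x' y' h' := by
  subst hx; subst hy; exact ⟨h, rfl⟩

lemma ec_neg {e f : ℤ} {x y : ℚ} (h : (EC e f).toAffine.Nonsingular x y) :
    ∃ h' : (EC e f).toAffine.Nonsingular x (-y),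
      -(Point.some x y h : Pt e f) = Point.some x (-y) h' := by
  rw [Point.neg_some]
  exact ec_some_congr _ rfl (by simp [negY, EC])

lemma ec_add {e f : ℤ} {x₁ y₁ x₂ y₂ : ℚ} (h₁ : (EC e f).toAffine.Nonsingular x₁ y₁)
    (h₂ : (EC e f).toAffine.Nonsingular x₂ y₂) (hx : x₁ ≠ x₂) (l x₃ : ℚ)
    (hl : l = (y₁ - y₂) / (x₁ - x₂)) (hx3 : x₃ = l ^ 2 + (e + f) - x₁ - x₂) :
    ∃ h' : (EC e f).toAffine.Nonsingular x₃ (-(l * (x₃ - x₁) + y₁)),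
      (Point.some x₁ y₁ h₁ + Point.some x₂ y₂ h₂ : Pt e f) = Point.some _ _ h' := by
  rw [Point.add_of_X_ne hx]
  subst hx3
  subst hl
  apply ec_some_congr
  · rw [slope_of_X_ne hx]; simp [addX, EC]; ring
  · rw [slope_of_X_ne hx]; simp only [addX, addY, negAddY, negY, EC]; ring

lemma ec_dbl {e f : ℤ} {x y : ℚ} (h : (EC e f).toAffine.Nonsingular x y) (hy : y ≠ 0) (l x₃ : ℚ)
    (hl : l = (3 * x ^ 2 - 2 * (e + f) * x + e * f) / (2 * y))
    (hx3 : x₃ = l ^ 2 + (e + f) - 2 * x) :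
    ∃ h' : (EC e f).toAffine.Nonsingular x₃ (-(l * (x₃ - x) + y)),
      (Point.some x y h + Point.some x y h : Pt e f) = Point.some _ _ h' := by
  have hy' : y ≠ (EC e f).toAffine.negY x y := by
    simp [negY, EC]; intro h0; exact hy (by linarith)
  have hs : (EC e f).toAffine.slope x x y y = l := by
    rw [slope_of_Y_ne rfl hy', hl]
    simp [negY, EC]; congr 1 <;> ring
  rw [Point.add_self_of_Y_ne hy']
  subst hx3
  apply ec_some_congr
  · rw [hs]; simp [addX, EC]; ring
  · rw [hs]; simp only [addX, addY, negAddY, negY, EC]; ring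

lemma ec_dbl0 {e f : ℤ} {x y : ℚ} (h : (EC e f).toAffine.Nonsingular x y) (hy : y = 0) :
    (Point.some x y h + Point.some x y h : Pt e f) = 0 := by
  apply Point.add_self_of_Y_eq
  simp [negY, EC, hy]

/-- The naive height. -/
noncomputable def hgt {e f : ℤ} (P : Pt e f) : ℝ := Height.logHeight P.xRep

lemma addsub_rel {e f : ℤ} (hg : Good e f) (P Q : Pt e f) : ∃ t : ℚ, t ≠ 0 ∧
    (fun i => ((EC e f).addSubMap i).eval (P.sym2x Q)) = t • (P + Q).sym2x (P - Q) := by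
  have key : ∀ v : Fin 3 → ℚ, (fun i => ((EC e f).addSubMap i).eval v) =
      ![v 0 ^ 2 - 2 * e * f * v 0 * v 2 + (e * f) ^ 2 * v 2 ^ 2,
        2 * v 1 * v 0 - 4 * (e + f) * v 0 * v 2 + 2 * e * f * v 1 * v 2,
        v 1 ^ 2 - 4 * v 0 * v 2] := by
    intro v
    ext i
    fin_cases i <;> simp [addSubMap, EC, WeierstrassCurve.b₂, WeierstrassCurve.b₄,
      WeierstrassCurve.b₆, WeierstrassCurve.b₈, -mul_eq_mul_left_iff, -mul_eq_mul_right_iff] <;> ring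
  rw [key]
  obtain ⟨g1, g2, g3⟩ := hg
  have g1 : (e : ℚ) ≠ 0 := by exact_mod_cast g1
  have g2 : (f : ℚ) ≠ 0 := by exact_mod_cast g2
  have g3 : (e : ℚ) - f ≠ 0 := sub_ne_zero.mpr (by exact_mod_cast g3)
  have self : ∀ (x y : ℚ) (h : (EC e f).toAffine.Nonsingular x y), ∃ t : ℚ, t ≠ 0 ∧
      ![(x * x) ^ 2 - 2 * e * f * (x * x) * 1 + (e * f) ^ 2 * 1 ^ 2,
        2 * (x + x) * (x * x) - 4 * (e + f) * (x * x) * 1 + 2 * e * f * (x + x) * 1,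
        (x + x) ^ 2 - 4 * (x * x) * 1]
       = t • (Point.some x y h + Point.some x y h : Pt e f).sym2x 0 := by
    intro x y h
    have hE := ec_of_ns h
    by_cases hy : y = 0
    · rw [ec_dbl0 h hy]
      refine ⟨(x ^ 2 - e * f) ^ 2, ?_, ?_⟩
      · apply pow_ne_zero
        have : x * (x - e) * (x - f) = 0 := by rw [← hE, hy]; ring
        rcases mul_eq_zero.mp this with h0 | h0
        · rcases mul_eq_zero.mp h0 with h0 | h0
          · rw [h0]
            have : (0 : ℚ) ^ 2 - e * f = -(e * f) := by ring
            rw [this]; exact neg_ne_zero.mpr (mul_ne_zero g1 g2)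
          · have hxe : x = e := by linarith
            have : x ^ 2 - e * f = e * (e - f) := by rw [hxe]; ring
            rw [this]; exact mul_ne_zero g1 g3
        · have hxf : x = f := by linarith
          have : x ^ 2 - e * f = - (f * (e - f)) := by rw [hxf]; ring
          rw [this]; exact neg_ne_zero.mpr (mul_ne_zero g2 g3)
      · simp only [Point.sym2x_zero_zero]
        subst hy
        ext i; fin_cases i <;> simp
        · ring
        · linear_combination (-4) * hE
        · ring
    · obtain ⟨h', hd⟩ := ec_dbl h hy _ _ rfl rfl
      rw [hd]
      refine ⟨4 * y ^ 2, by positivity, ?_⟩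
      simp only [Point.sym2x_some_zero]
      ext i; fin_cases i <;> simp
      · field_simp
        have : y ^ 2 = x * (x - e) * (x - f) := hE
        rw [this]; ring
      · rw [hE]; ring
      · ring
  rcases P with _ | ⟨x₁, y₁, h₁⟩ <;> rcases Q with _ | ⟨x₂, y₂, h₂⟩
  · simp only [← Point.zero_def]
    refine ⟨1, one_ne_zero, ?_⟩
    simp
  · simp only [← Point.zero_def]
    refine ⟨1, one_ne_zero, ?_⟩
    rw [zero_add, zero_sub, Point.sym2x_neg_right]
    simp; ring_nf; simp
  · simp only [← Point.zero_def]
    refine ⟨1, one_ne_zero, ?_⟩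
    rw [add_zero, sub_zero]
    simp; ring_nf; simp
  · by_cases hx : x₁ = x₂
    · rcases Point.X_eq_iff (h₁ := h₁) (h₂ := h₂) |>.mp hx with h | h
      · obtain ⟨t, ht, H⟩ := self _ _ h₂
        refine ⟨t, ht, ?_⟩
        rw [h, sub_self, ← H]
        simp
      · obtain ⟨t, ht, H⟩ := self _ _ h₂
        refine ⟨t, ht, ?_⟩
        have h5 : -Point.some x₂ y₂ h₂ - Point.some x₂ y₂ h₂
          = -(Point.some x₂ y₂ h₂ + Point.some x₂ y₂ h₂ : Pt e f) := by abel
        rw [h, neg_add_cancel, h5, Point.sym2x_neg_right, Point.sym2x_neg_left,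
          Point.sym2x_comm 0, ← H]
        simp
    · obtain ⟨h3, e3⟩ := ec_add h₁ h₂ hx _ _ rfl rfl
      obtain ⟨hn, en⟩ := ec_neg h₂
      obtain ⟨h4, e4⟩ := ec_add h₁ hn hx _ _ rfl rfl
      have E1 := ec_of_ns h₁
      have E2 := ec_of_ns h₂
      have hx' : x₁ - x₂ ≠ 0 := sub_ne_zero.mpr hx
      refine ⟨(x₁ - x₂) ^ 2, by positivity, ?_⟩
      have h5 : (Point.some x₁ y₁ h₁ - Point.some x₂ y₂ h₂ : Pt e f)
          = Point.some x₁ y₁ h₁ + -Point.some x₂ y₂ h₂ := sub_eq_add_neg _ _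
      rw [h5, en, e3, e4]
      simp only [Point.sym2x_some_some]
      have X3 : (((y₁ - y₂) / (x₁ - x₂)) ^ 2 + (e + f) - x₁ - x₂) * (x₁ - x₂) ^ 2
        = y₁ ^ 2 + y₂ ^ 2 + (x₁ - x₂) ^ 2 * (e + f - x₁ - x₂) - 2 * y₁ * y₂ := by
        field_simp; ring
      have X4 : (((y₁ - -y₂) / (x₁ - x₂)) ^ 2 + (e + f) - x₁ - x₂) * (x₁ - x₂) ^ 2
        = y₁ ^ 2 + y₂ ^ 2 + (x₁ - x₂) ^ 2 * (e + f - x₁ - x₂) + 2 * y₁ * y₂ := by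
        field_simp; ring
      generalize ((y₁ - y₂) / (x₁ - x₂)) ^ 2 + ((e : ℚ) + f) - x₁ - x₂ = x₃ at *
      generalize ((y₁ - -y₂) / (x₁ - x₂)) ^ 2 + ((e : ℚ) + f) - x₁ - x₂ = x₄ at *
      have A0 : (x₁ - x₂) ^ 2 * (x₃ * x₄) = (x₁ * x₂ - e * f) ^ 2 := by
        have h6 : (x₁ - x₂) ^ 2 ≠ 0 := by positivity
        apply mul_left_cancel₀ h6
        calc (x₁ - x₂) ^ 2 * ((x₁ - x₂) ^ 2 * (x₃ * x₄))
            = (x₃ * (x₁ - x₂) ^ 2) * (x₄ * (x₁ - x₂) ^ 2) := by ring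
          _ = (y₁ ^ 2 + y₂ ^ 2 + (x₁ - x₂) ^ 2 * (e + f - x₁ - x₂)) ^ 2
              - 4 * y₁ ^ 2 * y₂ ^ 2 := by rw [X3, X4]; ring
          _ = _ := by rw [E1, E2]; ring
      have A1 : (x₁ - x₂) ^ 2 * (x₃ + x₄)
          = 2 * (y₁ ^ 2 + y₂ ^ 2 + (x₁ - x₂) ^ 2 * (e + f - x₁ - x₂)) := by
        linear_combination X3 + X4
      rw [E1, E2] at A1
      ext i; fin_cases i <;> simp
      · rw [A0]; ring
      · rw [A1]; ring
      · ring

lemma hgt_zero {e f : ℤ} : hgt (0 : Pt e f) = 0 := by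
  have : (![1, 0] : Fin 2 → ℚ) = Pi.single 0 1 := by
    ext i; fin_cases i <;> simp
  have h2 : hgt (0 : Pt e f) = Height.logHeight (![1, 0] : Fin 2 → ℚ) := by
    simp [hgt]
  rw [h2, ← Height.logHeight_swap, ← Height.logHeight₁_eq_logHeight]
  simp

lemma hgt_some {e f : ℤ} {x y : ℚ} (h : (EC e f).toAffine.Nonsingular x y) :
    hgt (Point.some x y h : Pt e f) = Real.log (max x.num.natAbs x.den : ℕ) := by
  rw [← Rat.logHeight₁_eq_log_max, Height.logHeight₁_eq_logHeight]
  simp [hgt]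

lemma hgt_nonneg {e f : ℤ} (P : Pt e f) : 0 ≤ hgt P := by
  rcases P with _ | ⟨x, y, h⟩
  · rw [← Point.zero_def, hgt_zero]
  · rw [hgt_some]
    exact Real.log_natCast_nonneg _

lemma hgt_par {e f : ℤ} (hg : Good e f) : ∃ C : ℝ, ∀ P Q : Pt e f,
    |hgt (P + Q) + hgt (P - Q) - 2 * (hgt P + hgt Q)| ≤ C := by
  have := ec_elliptic hg
  obtain ⟨C1, h1⟩ := WeierstrassCurve.abs_logHeight_addSubMap_sub_two_mul_logHeight_le (EC e f)
  obtain ⟨C2, h2⟩ := Height.abs_logHeight_sym2_sub_le ℚ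
  have h3 : ∀ P Q : Pt e f, |Height.logHeight (P.sym2x Q) - (hgt P + hgt Q)| ≤ C2 := by
    intro P Q
    have e1 : ∀ P : Pt e f, P.xRep = ![P.xRep 0, P.xRep 1] := by
      intro P; ext i; fin_cases i <;> simp
    have e2 : ∀ P : Pt e f, ![P.xRep 0, P.xRep 1] ≠ 0 := by
      intro P h0
      rcases P with _ | ⟨x, y, h⟩
      · have := congrFun h0 0
        rw [← Point.zero_def] at this
        simp at this
      · have := congrFun h0 1
        simp at this
    have := h2 (e2 P) (e2 Q)
    rw [← e1, ← e1] at this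
    exact this
  refine ⟨C1 + 3 * C2, fun P Q => ?_⟩
  obtain ⟨t, ht, H⟩ := addsub_rel hg P Q
  have a1 := h1 (P.sym2x Q)
  rw [H, Height.logHeight_smul_eq_logHeight _ ht] at a1
  have a2 := h3 P Q
  have a3 := h3 (P + Q) (P - Q)
  rw [abs_le] at *
  constructor <;> linarith [a1.1, a1.2, a2.1, a2.2, a3.1, a3.2]

lemma hgt_northcott (e f : ℤ) : Northcott (hgt : Pt e f → ℝ) := by
  refine ⟨fun b => ?_⟩
  have hN : {x : ℚ | Height.logHeight₁ x ≤ b}.Finite := Northcott.finite_le b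
  have hfin : (⋃ x ∈ {x : ℚ | Height.logHeight₁ x ≤ b},
      {y : ℚ | y ^ 2 = x * (x - e) * (x - f)} ).Finite := by
    apply Set.Finite.biUnion hN
    intro x _
    by_cases hy : ∃ y0 : ℚ, y0 ^ 2 = x * (x - e) * (x - f)
    · obtain ⟨y0, hy0⟩ := hy
      apply Set.Finite.subset (Set.toFinite {y0, -y0})
      intro y hy
      have hy' : y ^ 2 = y0 ^ 2 := by rw [hy0]; exact hy
      exact sq_eq_sq_iff_eq_or_eq_neg.mp hy'
    · apply Set.Finite.subset (Set.finite_empty)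
      intro y hy2
      exact hy ⟨y, hy2⟩
  have hF := hN.prod hfin
  let g : ℚ × ℚ → Pt e f := fun p => by
    classical exact if h : (EC e f).toAffine.Nonsingular p.1 p.2 then Point.some p.1 p.2 h else 0
  apply Set.Finite.subset ((hF.image g).union (Set.finite_singleton 0))
  intro P hP
  rcases P with _ | ⟨x, y, h⟩
  · right; rfl
  · left
    have hx : Height.logHeight₁ x ≤ b := by
      have : hgt (Point.some x y h : Pt e f) ≤ b := hP
      rw [hgt_some, ← Rat.logHeight₁_eq_log_max] at this
      exact this
    refine ⟨(x, y), ⟨hx, ?_⟩, ?_⟩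
    · simp only [Set.mem_iUnion]
      exact ⟨x, hx, ec_of_ns h⟩
    · simp [g, h]

lemma ec_fg {e f : ℤ} (hg : Good e f)
    (hw : (nsmulAddMonoidHom (α := Pt e f) 2).range.FiniteIndex) : AddGroup.FG (Pt e f) := by
  obtain ⟨C, hC⟩ := hgt_par hg
  have := hgt_northcott e f
  exact AddCommGroup.fg_of_descent' hw hgt_nonneg hC

lemma ec_half {e f : ℤ} (hg : Good e f) {x y : ℚ} (h : (EC e f).toAffine.Nonsingular x y)
    (r₁ r₂ r₃ : ℚ) (h1 : x = r₁ ^ 2) (h2 : x - e = r₂ ^ 2) (h3 : x - f = r₃ ^ 2) :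
    ∃ R : Pt e f, R + R = Point.some x y h := by
  have main : ∀ r₁ : ℚ, x = r₁ ^ 2 → y = r₁ * r₂ * r₃ → ∃ R : Pt e f, R + R = Point.some x y h := by
    intro r₁ h1 hy
    have he : (e : ℚ) = r₁ ^ 2 - r₂ ^ 2 := by rw [← h1, ← h2]; ring
    have hf : (f : ℚ) = r₁ ^ 2 - r₃ ^ 2 := by rw [← h1, ← h3]; ring
    obtain ⟨g1, g2, g3⟩ := id hg
    have g1 : (e : ℚ) ≠ 0 := by exact_mod_cast g1
    have g2 : (f : ℚ) ≠ 0 := by exact_mod_cast g2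
    have g3 : (e : ℚ) - f ≠ 0 := sub_ne_zero.mpr (by exact_mod_cast g3)
    have k1 : r₁ + r₂ ≠ 0 := by
      intro h0; apply g1; rw [he]; linear_combination (r₁ - r₂) * h0
    have k2 : r₁ + r₃ ≠ 0 := by
      intro h0; apply g2; rw [hf]; linear_combination (r₁ - r₃) * h0
    have k3 : r₂ + r₃ ≠ 0 := by
      intro h0; apply g3; rw [he, hf]; linear_combination (r₃ - r₂) * h0
    have hR := ec_ns hg (x := (r₁ + r₂) * (r₁ + r₃))
      (y := (r₁ + r₂) * (r₁ + r₃) * (r₂ + r₃)) (by rw [he, hf]; ring)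
    refine ⟨Point.some _ _ hR, ?_⟩
    obtain ⟨h', hd⟩ := ec_dbl hR (by positivity) (r₁ + r₂ + r₃) x
      (by rw [he, hf]; field_simp; ring) (by rw [he, hf, h1]; ring)
    rw [hd]
    obtain ⟨h'', hd'⟩ := ec_some_congr h' rfl (y' := y) (by rw [h1, hy]; ring)
    rw [hd']
  have hE := ec_of_ns h
  have : y ^ 2 = (r₁ * r₂ * r₃) ^ 2 := by rw [hE, h2, h3, h1]; ring
  rcases sq_eq_sq_iff_eq_or_eq_neg.mp this with h0 | h0
  · exact main r₁ h1 h0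
  · exact main (-r₁) (by rw [h1]; ring) (by rw [h0]; ring)

lemma add_id {e f x₁ y₁ x₂ y₂ l t : ℚ} (hx : x₁ - x₂ ≠ 0) (E1 : y₁ ^ 2 = x₁ * (x₁ - e) * (x₁ - f))
    (E2 : y₂ ^ 2 = x₂ * (x₂ - e) * (x₂ - f)) (hl : l = (y₁ - y₂) / (x₁ - x₂)) :
    t * (t - e) * (t - f) - (l * (t - x₁) + y₁) ^ 2
      = (t - x₁) * (t - x₂) * (t - (l ^ 2 + (e + f) - x₁ - x₂)) := by
  have hy : y₂ = y₁ - l * (x₁ - x₂) := by rw [hl]; field_simp; ring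
  subst hy
  apply mul_left_cancel₀ hx
  linear_combination (t - x₁) * E2 - (t - x₂) * E1

lemma sq_class {u y : ℚ} {a b : ℤ} (h : y ^ 2 = u * (u - a) * (u - b)) :
    ∃ c : ℤ, c ∣ a * b ∧ ∃ w : ℚ, u = c * w ^ 2 := by
  by_cases hu : u = 0
  · exact ⟨a * b, dvd_rfl, 0, by simp [hu]⟩
  set n := u.num with hn
  set q : ℤ := (u.den : ℤ) with hq
  have hq0 : (0 : ℤ) < q := by rw [hq]; exact_mod_cast u.den_pos
  have hqQ : (q : ℚ) ≠ 0 := by exact_mod_cast hq0.ne'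
  have hun : u = n / q := by rw [hn, hq]; exact_mod_cast (Rat.num_div_den u).symm
  have hn0 : n ≠ 0 := by rw [hn]; exact Rat.num_ne_zero.mpr hu
  have cop : IsCoprime n q := Rat.isCoprime_num_den u
  have e1 : (y * q ^ 2) ^ 2 = ((q * (n * ((n - a * q) * (n - b * q))) : ℤ) : ℚ) := by
    push_cast
    rw [mul_pow, h, hun]; field_simp
  obtain ⟨Y, hY⟩ : ∃ Y : ℤ, Y ^ 2 = q * (n * ((n - a * q) * (n - b * q))) := by
    have : IsSquare (((q * (n * ((n - a * q) * (n - b * q))) : ℤ) : ℚ)) :=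
      ⟨y * q ^ 2, by rw [← e1]; ring⟩
    rw [Rat.isSquare_intCast_iff] at this
    obtain ⟨Y, hY⟩ := this
    exact ⟨Y, by rw [hY]; ring⟩
  have cop2 : IsCoprime q (n * ((n - a * q) * (n - b * q))) := by
    have c1 : ∀ a : ℤ, IsCoprime q (n - a * q) := by
      intro a
      have := (cop.symm).add_mul_right_right (-a)
      have e2 : n - a * q = n + -a * q := by ring
      rw [e2]; exact this
    exact (cop.symm).mul_right ((c1 a).mul_right (c1 b))
  obtain ⟨k, hk⟩ := Int.sq_of_isCoprime cop2 hY.symm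
  have hk : q = k ^ 2 := by
    rcases hk with hk | hk
    · exact hk
    · nlinarith [sq_nonneg k]
  obtain ⟨Z, hZ⟩ := Int.sq_of_isCoprime cop2.symm (by rw [mul_comm]; exact hY.symm)
  have hZ' : ∃ Z m : ℤ, n * m = Z ^ 2 ∧ m ∣ (n - a * q) * (n - b * q) ∧
      (n - a * q) * (n - b * q) ∣ m := by
    rcases hZ with hZ | hZ
    · exact ⟨Z, _, hZ, dvd_rfl, dvd_rfl⟩
    · exact ⟨Z, -((n - a * q) * (n - b * q)), by rw [mul_neg, hZ, neg_neg],
        (neg_dvd.mpr dvd_rfl), (dvd_neg.mpr dvd_rfl)⟩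
  clear hZ
  obtain ⟨Z, m, hZ, hm1, hm2⟩ := hZ'
  have hg0 : 0 < Int.gcd n m := Int.gcd_pos_of_ne_zero_left _ hn0
  obtain ⟨n', m', hc, hn', hm'⟩ := Int.exists_gcd_one hg0
  set g : ℤ := (Int.gcd n m : ℤ) with hgdef
  have hgz : g ≠ 0 := by rw [hgdef]; exact_mod_cast hg0.ne'
  have hgZ : g ∣ Z := by
    rw [← Int.pow_dvd_pow_iff (n := 2) (by norm_num), ← hZ]
    exact ⟨n' * m', by rw [hn', hm']; ring⟩
  obtain ⟨Z', hZ2⟩ := hgZ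
  have hnm : n' * m' = Z' ^ 2 := by
    have : g ^ 2 ≠ 0 := pow_ne_zero _ hgz
    apply mul_left_cancel₀ this
    calc g ^ 2 * (n' * m') = (n' * g) * (m' * g) := by ring
      _ = n * m := by rw [← hn', ← hm']
      _ = g ^ 2 * Z' ^ 2 := by rw [hZ, hZ2]; ring
  have hgn : g ∣ n := ⟨n', by rw [mul_comm]; exact hn'⟩
  have hgm : g ∣ (n - a * q) * (n - b * q) := (Dvd.intro_left m' hm'.symm).trans hm1
  have hgab : g ∣ a * b := by
    have h1 : g ∣ (a * b) * q ^ 2 := by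
      have : (a * b) * q ^ 2 = (n - a * q) * (n - b * q) - n * (n - a * q - b * q) := by ring
      rw [this]
      exact dvd_sub hgm (hgn.mul_right _)
    have h2 : IsCoprime g (q ^ 2) := (cop.of_isCoprime_of_dvd_left hgn).pow_right
    exact h2.dvd_of_dvd_mul_right h1
  obtain ⟨t, ht⟩ := Int.sq_of_gcd_eq_one hc hnm
  have hkz : (k : ℚ) ≠ 0 := by
    intro h0; apply hqQ; rw [hk]; push_cast; rw [h0]; ring
  rcases ht with ht | ht
  · refine ⟨g, hgab, t / k, ?_⟩
    rw [hun, hn', ht, hk]; push_cast; field_simp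
  · refine ⟨-g, (neg_dvd.mpr hgab), t / k, ?_⟩
    rw [hun, hn', ht, hk]; push_cast; field_simp

lemma ec_same_class {e f : ℤ} (hg : Good e f) {x₁ y₁ x₂ y₂ : ℚ}
    (h₁ : (EC e f).toAffine.Nonsingular x₁ y₁) (h₂ : (EC e f).toAffine.Nonsingular x₂ y₂)
    (hy₁ : y₁ ≠ 0) (hy₂ : y₂ ≠ 0) (c : Fin 3 → ℤ)
    (a0 : ∃ w : ℚ, x₁ = c 0 * w ^ 2) (a1 : ∃ w : ℚ, x₁ - e = c 1 * w ^ 2)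
    (a2 : ∃ w : ℚ, x₁ - f = c 2 * w ^ 2)
    (b0 : ∃ w : ℚ, x₂ = c 0 * w ^ 2) (b1 : ∃ w : ℚ, x₂ - e = c 1 * w ^ 2)
    (b2 : ∃ w : ℚ, x₂ - f = c 2 * w ^ 2) :
    ∃ R : Pt e f, R + R = Point.some x₁ y₁ h₁ - Point.some x₂ y₂ h₂ := by
  by_cases hx : x₁ = x₂
  · rcases Point.X_eq_iff (h₁ := h₁) (h₂ := h₂) |>.mp hx with h | h
    · exact ⟨0, by rw [h]; simp⟩
    · exact ⟨-Point.some x₂ y₂ h₂, by rw [h]; abel⟩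
  · have hx' := sub_ne_zero.mpr hx
    have E1 := ec_of_ns h₁
    have E2 := ec_of_ns h₂
    set l := (y₁ - y₂) / (x₁ - x₂) with hl
    set x₃ := l ^ 2 + ((e : ℚ) + f) - x₁ - x₂ with hx3
    obtain ⟨h3, e3⟩ := ec_add h₁ h₂ hx l x₃ rfl rfl
    have id := fun t : ℚ => add_id (t := t) hx' E1 E2 hl
    have n1 : x₁ * (x₁ - e) * (x₁ - f) ≠ 0 := by rw [← E1]; positivity
    have n2 : x₂ * (x₂ - e) * (x₂ - f) ≠ 0 := by rw [← E2]; positivity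
    have key : ∀ (t : ℚ) (c : ℤ), t * (t - e) * (t - f) = 0 → x₁ - t ≠ 0 → x₂ - t ≠ 0 →
        (∃ w : ℚ, x₁ - t = c * w ^ 2) → (∃ w : ℚ, x₂ - t = c * w ^ 2) →
        ∃ r : ℚ, x₃ - t = r ^ 2 := by
      rintro t c ht k1 k2 ⟨w, hw⟩ ⟨v, hv⟩
      have := id t
      rw [ht, ← hx3] at this
      refine ⟨(l * (t - x₁) + y₁) / (c * w * v), ?_⟩
      have hp : ((c : ℚ) * w * v) ^ 2 = (x₁ - t) * (x₂ - t) := by rw [hw, hv]; ring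
      rw [div_pow, hp, eq_div_iff (mul_ne_zero k1 k2)]
      linear_combination this
    have m1 := mul_ne_zero_iff.mp n1
    have m2 := mul_ne_zero_iff.mp n2
    have p1 := mul_ne_zero_iff.mp m1.1
    have p2 := mul_ne_zero_iff.mp m2.1
    obtain ⟨r1, hr1⟩ := key 0 (c 0) (by ring) (by simpa using p1.1) (by simpa using p2.1)
      (by simpa using a0) (by simpa using b0)
    obtain ⟨r2, hr2⟩ := key e (c 1) (by ring) p1.2 p2.2 a1 b1
    obtain ⟨r3, hr3⟩ := key f (c 2) (by ring) m1.2 m2.2 a2 b2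
    obtain ⟨R, hR⟩ := ec_half hg h3 r1 r2 r3 (by linarith) hr2 hr3
    refine ⟨R - Point.some x₂ y₂ h₂, ?_⟩
    have : R - Point.some x₂ y₂ h₂ + (R - Point.some x₂ y₂ h₂)
      = (R + R) - Point.some x₂ y₂ h₂ - Point.some x₂ y₂ h₂ := by abel
    rw [this, hR, ← e3]; abel

lemma finIndex_of_cover {G T : Type*} [AddCommGroup G] (H : AddSubgroup G) (S : Set T)
    (hS : S.Finite) (R : G → T → Prop) (h1 : ∀ P, ∃ t ∈ S, R P t)
    (h2 : ∀ P Q t, R P t → R Q t → P - Q ∈ H) : H.FiniteIndex := by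
  have := hS.to_subtype
  choose φ hφS hφ using h1
  have : Finite (G ⧸ H) := by
    apply Finite.of_injective (fun q : G ⧸ H => (⟨φ q.out, hφS _⟩ : S))
    intro q q' hqq
    have h3 : φ q.out = φ q'.out := congrArg Subtype.val hqq
    have h4 := h2 _ _ _ (hφ q'.out) (h3 ▸ hφ q.out)
    rw [← QuotientAddGroup.out_eq' q, ← QuotientAddGroup.out_eq' q', QuotientAddGroup.eq]
    rw [sub_eq_add_neg, add_comm] at h4
    exact h4
  exact AddSubgroup.finiteIndex_of_finite_quotient

/-- The class relation used for the weak Mordell-Weil theorem. -/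
def ClsRel {e f : ℤ} (P : Pt e f) (t : (Fin 3 → ℤ) ⊕ Pt e f) : Prop :=
  (∃ c, t = Sum.inl c ∧ ∃ (x y : ℚ) (h : (EC e f).toAffine.Nonsingular x y),
    P = Point.some x y h ∧ y ≠ 0 ∧ (∃ w : ℚ, x = c 0 * w ^ 2) ∧ (∃ w : ℚ, x - e = c 1 * w ^ 2) ∧
      (∃ w : ℚ, x - f = c 2 * w ^ 2)) ∨ t = Sum.inr P

lemma weak_mw {e f : ℤ} (hg : Good e f) :
    (nsmulAddMonoidHom (α := Pt e f) 2).range.FiniteIndex := by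
  have := hgt_northcott e f
  obtain ⟨b, hb⟩ : ∃ b : ℝ, ∀ x ∈ ({0, (e : ℚ), (f : ℚ)} : Set ℚ), Height.logHeight₁ x ≤ b := by
    have : ({0, (e : ℚ), (f : ℚ)} : Set ℚ).Finite := Set.toFinite _
    obtain ⟨b, hb⟩ := (this.image Height.logHeight₁).bddAbove
    exact ⟨b, fun x hx => hb ⟨x, hx, rfl⟩⟩
  have hF : {P : Pt e f | hgt P ≤ max b 0}.Finite := Northcott.finite_le _
  have g1 := hg.1
  have g2 := hg.2.1
  have g3 := sub_ne_zero.mpr hg.2.2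
  have hD : ∀ M : ℤ, M ≠ 0 → {c : ℤ | c ∣ M}.Finite := by
    intro M hM
    apply Set.Finite.subset (Set.finite_Icc (-|M|) |M|)
    intro c hc
    have := Int.le_of_dvd (abs_pos.mpr hM) ((abs_dvd_abs c M).mpr hc)
    exact abs_le.mp this
  let M : Fin 3 → ℤ := ![e * f, (-e) * (f - e), (-f) * (e - f)]
  have hM : ∀ i, M i ≠ 0 := by
    have g3' : f - e ≠ 0 := by intro h; apply g3; linarith
    intro i; fin_cases i
    · exact mul_ne_zero g1 g2
    · exact mul_ne_zero (neg_ne_zero.mpr g1) g3'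
    · exact mul_ne_zero (neg_ne_zero.mpr g2) g3
  have hP : (Set.pi Set.univ (fun i => {c : ℤ | c ∣ M i})).Finite :=
    Set.Finite.pi (fun i => hD _ (hM i))
  apply finIndex_of_cover _ ((Set.image Sum.inl (Set.pi Set.univ (fun i => {c : ℤ | c ∣ M i}))) ∪
    Set.image Sum.inr {P : Pt e f | hgt P ≤ max b 0}) ((hP.image _).union (hF.image _)) ClsRel
  · intro P
    rcases P with _ | ⟨x, y, h⟩
    · refine ⟨Sum.inr 0, Or.inr ⟨0, ?_, rfl⟩, Or.inr rfl⟩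
      change hgt (0 : Pt e f) ≤ _
      rw [hgt_zero]; exact le_max_right _ _
    · have hE := ec_of_ns h
      by_cases hy : y = 0
      · refine ⟨Sum.inr (Point.some x y h), Or.inr ⟨_, ?_, rfl⟩, Or.inr rfl⟩
        change hgt _ ≤ _
        rw [hgt_some, ← Rat.logHeight₁_eq_log_max]
        refine (hb x ?_).trans (le_max_left _ _)
        have h0 : x * (x - e) * (x - f) = 0 := by rw [← hE, hy]; ring
        rcases mul_eq_zero.mp h0 with h0 | h0
        · rcases mul_eq_zero.mp h0 with h0 | h0
          · simp [h0]
          · have : x = e := by linarith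
            simp [this]
        · have : x = f := by linarith
          simp [this]
      · obtain ⟨c0, d0, w0⟩ := sq_class hE
        obtain ⟨c1, d1, w1⟩ := sq_class (u := x - e) (y := y) (a := -e) (b := f - e)
          (by rw [hE]; push_cast; ring)
        obtain ⟨c2, d2, w2⟩ := sq_class (u := x - f) (y := y) (a := -f) (b := e - f)
          (by rw [hE]; push_cast; ring)
        refine ⟨Sum.inl ![c0, c1, c2], Or.inl ⟨_, ?_, rfl⟩,
          Or.inl ⟨_, rfl, x, y, h, rfl, hy, w0, w1, w2⟩⟩
        intro i _
        fin_cases i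
        · exact d0
        · exact d1
        · exact d2
  · intro P Q t hP hQ
    have : ∃ R : Pt e f, R + R = P - Q := by
      rcases hP with ⟨c, rfl, x, y, h, rfl, hy, w0, w1, w2⟩ | rfl
      · rcases hQ with ⟨c', hc, x', y', h', rfl, hy', w0', w1', w2'⟩ | hQ
        · cases hc
          exact ec_same_class hg h h' hy hy' c w0 w1 w2 w0' w1' w2'
        · cases hQ
      · rcases hQ with ⟨c', hc, _⟩ | hQ
        · cases hc
        · cases hQ
          exact ⟨0, by simp⟩
    obtain ⟨R, hR⟩ := this
    exact ⟨R, by rw [← hR]; simp [two_nsmul]⟩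

lemma mordell_weil {e f : ℤ} (hg : Good e f) : AddGroup.FG (Pt e f) := ec_fg hg (weak_mw hg)

lemma pn_sub_int {p : ℕ} [Fact p.Prime] {x : ℚ} (hx : 1 < padicNorm p x) (n : ℤ) :
    padicNorm p (x - n) = padicNorm p x := by
  have h1 := padicNorm.of_int (p := p) n
  have h2 : padicNorm p x ≠ padicNorm p (-(n : ℚ)) := by
    rw [padicNorm.neg]; exact ne_of_gt (lt_of_le_of_lt h1 hx)
  rw [sub_eq_add_neg, padicNorm.add_eq_max_of_ne h2, padicNorm.neg]
  exact max_eq_left (h1.trans hx.le)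

lemma pn_y {p : ℕ} [Fact p.Prime] {e f : ℤ} {x y : ℚ} (h : y ^ 2 = x * (x - e) * (x - f))
    (hx : 1 < padicNorm p x) : padicNorm p y ^ 2 = padicNorm p x ^ 3 := by
  rw [sq, ← padicNorm.mul, ← sq, h, padicNorm.mul, padicNorm.mul, pn_sub_int hx, pn_sub_int hx]
  ring

lemma pn_sq {p : ℕ} [Fact p.Prime] (x : ℚ) : padicNorm p (x ^ 2) = padicNorm p x ^ 2 := by
  rw [sq, padicNorm.mul, sq]

/-- The local condition. -/
def Lc (p : ℕ) (D : ℚ) (x : ℚ) : Prop := 1 ≤ padicNorm p x * D ^ 2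

lemma lc_gt {p : ℕ} {D x : ℚ} (hD0 : 0 < D) (hD1 : D < 1) (h : Lc p D x) : 1 < padicNorm p x := by
  unfold Lc at h
  by_contra h1
  push Not at h1
  have : D ^ 2 < 1 := by nlinarith
  have h3 : padicNorm p x * D ^ 2 ≤ 1 * D ^ 2 := by gcongr
  linarith

lemma lc_add {p : ℕ} [Fact p.Prime] {e f : ℤ} {x₁ y₁ x₂ y₂ x₃ D : ℚ} (hD0 : 0 < D) (hD1 : D < 1)
    (E1 : y₁ ^ 2 = x₁ * (x₁ - e) * (x₁ - f)) (E2 : y₂ ^ 2 = x₂ * (x₂ - e) * (x₂ - f))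
    (h1 : Lc p D x₁) (h2 : Lc p D x₂)
    (hr : x₃ * (x₁ * y₂ + x₂ * y₁) ^ 2 = x₁ * x₂ * (x₁ * x₂ - e * f) ^ 2) : Lc p D x₃ := by
  have g1 := lc_gt hD0 hD1 h1
  have g2 := lc_gt hD0 hD1 h2
  have Y1 := pn_y E1 g1
  have Y2 := pn_y E2 g2
  unfold Lc at *
  have N := congrArg (padicNorm p) hr
  have hp : padicNorm p (x₁ * x₂ - e * f) = padicNorm p x₁ * padicNorm p x₂ := by
    have : 1 < padicNorm p (x₁ * x₂) := by rw [padicNorm.mul]; nlinarith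
    have := pn_sub_int this (e * f)
    push_cast at this
    rw [this, padicNorm.mul]
  rw [padicNorm.mul, pn_sq, padicNorm.mul, padicNorm.mul, pn_sq, hp] at N
  have hmax := padicNorm.nonarchimedean (p := p) (q := x₁ * y₂) (r := x₂ * y₁)
  rw [padicNorm.mul, padicNorm.mul] at hmax
  have n0 : 0 ≤ padicNorm p (x₁ * y₂ + x₂ * y₁) := padicNorm.nonneg _
  have n1 : 0 ≤ padicNorm p y₁ := padicNorm.nonneg _
  have n2 : 0 ≤ padicNorm p y₂ := padicNorm.nonneg _
  have n3 : 0 ≤ padicNorm p x₃ := padicNorm.nonneg _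
  generalize padicNorm p (x₁ * y₂ + x₂ * y₁) = S at *
  generalize padicNorm p x₁ = a at *
  generalize padicNorm p x₂ = b at *
  generalize padicNorm p x₃ = c at *
  generalize padicNorm p y₁ = u at *
  generalize padicNorm p y₂ = v at *
  have ha : 0 < a := by linarith
  have hb : 0 < b := by linarith
  have hS : S ^ 2 ≤ D ^ 2 * (a * b) ^ 3 := by
    rcases le_max_iff.mp hmax with h | h
    · calc S ^ 2 ≤ (a * v) ^ 2 := by gcongr
        _ = 1 * (a ^ 2 * b ^ 3) := by rw [mul_pow, Y2]; ring
        _ ≤ (a * D ^ 2) * (a ^ 2 * b ^ 3) := by gcongr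
        _ = _ := by ring
    · calc S ^ 2 ≤ (b * u) ^ 2 := by gcongr
        _ = 1 * (b ^ 2 * a ^ 3) := by rw [mul_pow, Y1]; ring
        _ ≤ (b * D ^ 2) * (b ^ 2 * a ^ 3) := by gcongr
        _ = _ := by ring
  have hab : 0 < (a * b) ^ 3 := by positivity
  have : (a * b) ^ 3 * 1 ≤ (a * b) ^ 3 * (c * D ^ 2) := by
    calc (a * b) ^ 3 * 1 = c * S ^ 2 := by rw [N]; ring
      _ ≤ c * (D ^ 2 * (a * b) ^ 3) := by gcongr
      _ = _ := by ring
  exact le_of_mul_le_mul_left this hab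

lemma lc_dbl {p : ℕ} [Fact p.Prime] {e f : ℤ} {x y x₃ D : ℚ} (hD0 : 0 < D) (hD1 : D < 1)
    (E1 : y ^ 2 = x * (x - e) * (x - f)) (h1 : Lc p D x)
    (hr : x₃ * (4 * y ^ 2) = (x ^ 2 - e * f) ^ 2) : Lc p D x₃ := by
  have g1 := lc_gt hD0 hD1 h1
  have Y1 := pn_y E1 g1
  unfold Lc at *
  have N := congrArg (padicNorm p) hr
  have hp : padicNorm p (x ^ 2 - e * f) = padicNorm p x ^ 2 := by
    have : 1 < padicNorm p (x ^ 2) := by rw [pn_sq]; nlinarith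
    have := pn_sub_int this (e * f)
    push_cast at this
    rw [this, pn_sq]
  rw [padicNorm.mul, pn_sq, padicNorm.mul, pn_sq, hp, Y1] at N
  have h4 : padicNorm p 4 ≤ 1 := by simpa using padicNorm.of_int (p := p) 4
  have n3 : 0 ≤ padicNorm p x₃ := padicNorm.nonneg _
  have n4 : 0 ≤ padicNorm p 4 := padicNorm.nonneg _
  generalize padicNorm p x = a at *
  generalize padicNorm p x₃ = c at *
  generalize padicNorm p 4 = w at *
  have ha : 0 < a := by linarith
  have : a ^ 3 * a ≤ a ^ 3 * c := by
    calc a ^ 3 * a = c * (w * a ^ 3) := by rw [N]; ring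
      _ ≤ c * (1 * a ^ 3) := by gcongr
      _ = _ := by ring
  have hac : a ≤ c := le_of_mul_le_mul_left this (by positivity)
  calc 1 ≤ a * D ^ 2 := h1
    _ ≤ c * D ^ 2 := by gcongr

lemma pn_D {p D : ℕ} [Fact p.Prime] (hD : 0 < D) (hp : p ∣ D) :
    0 < padicNorm p (D : ℚ) ∧ padicNorm p (D : ℚ) < 1 := by
  constructor
  · have : padicNorm p (D : ℚ) ≠ 0 := padicNorm.nonzero (by exact_mod_cast hD.ne')
    exact lt_of_le_of_ne (padicNorm.nonneg _) this.symm
  · exact (padicNorm.nat_lt_one_iff D).mpr hp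

/-- Points reducing to zero modulo `D`. -/
def Lam {e f : ℤ} (D : ℕ) (hD : 0 < D) : AddSubgroup (Pt e f) where
  carrier := {P | ∀ x y h, P = Point.some x y h → ∀ p : ℕ, p.Prime → p ∣ D →
    Lc p (padicNorm p D) x}
  zero_mem' := by
    intro x y h h0
    simp [Point.zero_def] at h0
  neg_mem' := by
    intro P hP
    rcases P with _ | ⟨x, y, h⟩
    · intro x y h h0
      rw [← Point.zero_def, neg_zero] at h0
      simp [Point.zero_def] at h0
    · obtain ⟨h', hn⟩ := ec_neg h
      intro x' y' h'' h0 p hp hpD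
      rw [hn] at h0
      have : x' = x := by injection h0 with h1 _; exact h1.symm
      rw [this]
      exact hP x y h rfl p hp hpD
  add_mem' := by
    intro P Q hP hQ
    rcases P with _ | ⟨x₁, y₁, h₁⟩
    · rw [← Point.zero_def, zero_add]; exact hQ
    rcases Q with _ | ⟨x₂, y₂, h₂⟩
    · rw [← Point.zero_def, add_zero]; exact hP
    have E1 := ec_of_ns h₁
    have E2 := ec_of_ns h₂
    intro x₃ y₃ h₃ h0 p hp hpD
    have : Fact p.Prime := ⟨hp⟩
    have L1 := hP x₁ y₁ h₁ rfl p hp hpD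
    have L2 := hQ x₂ y₂ h₂ rfl p hp hpD
    obtain ⟨D0, D1⟩ := pn_D hD hpD
    by_cases hx : x₁ = x₂
    · rcases Point.X_eq_iff (h₁ := h₁) (h₂ := h₂) |>.mp hx with h | h
      · rw [h] at h0
        by_cases hy : y₂ = 0
        · rw [ec_dbl0 h₂ hy] at h0
          simp [Point.zero_def] at h0
        · obtain ⟨h', hd⟩ := ec_dbl h₂ hy _ _ rfl rfl
          rw [hd] at h0
          injection h0 with hx3 _
          apply lc_dbl D0 D1 E2 L2
          rw [← hx3]
          field_simp
          rw [E2]; ring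
      · rw [h, neg_add_cancel] at h0
        simp [Point.zero_def] at h0
    · obtain ⟨h', hd⟩ := ec_add h₁ h₂ hx _ _ rfl rfl
      rw [hd] at h0
      injection h0 with hx3 _
      have hx' := sub_ne_zero.mpr hx
      apply lc_add D0 D1 E1 E2 L1 L2
      have q1 := add_id (t := 0) hx' E1 E2 rfl
      rw [hx3] at q1
      have q2 : x₁ * x₂ * x₃ * (x₁ - x₂) ^ 2 = (x₁ * y₂ - x₂ * y₁) ^ 2 := by
        have : x₁ * x₂ * x₃ = ((y₁ - y₂) / (x₁ - x₂) * (0 - x₁) + y₁) ^ 2 := by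
          linear_combination q1
        rw [this]; field_simp; ring
      have G1 := lc_gt D0 D1 L1
      have G2 := lc_gt D0 D1 L2
      have z1 : x₁ ≠ 0 := by rintro rfl; simp at G1; linarith
      have z2 : x₂ ≠ 0 := by rintro rfl; simp at G2; linarith
      have hne : x₁ * x₂ * (x₁ - x₂) ^ 2 ≠ 0 := by positivity
      apply mul_left_cancel₀ hne
      calc x₁ * x₂ * (x₁ - x₂) ^ 2 * (x₃ * (x₁ * y₂ + x₂ * y₁) ^ 2)
          = (x₁ * x₂ * x₃ * (x₁ - x₂) ^ 2) * (x₁ * y₂ + x₂ * y₁) ^ 2 := by ring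
        _ = (x₁ ^ 2 * y₂ ^ 2 - x₂ ^ 2 * y₁ ^ 2) ^ 2 := by rw [q2]; ring
        _ = _ := by rw [E1, E2]; ring

lemma lam_hgt {e f : ℤ} {D : ℕ} (hD : 0 < D) {R : Pt e f} (hR : R ∈ (Lam D hD : AddSubgroup (Pt e f)))
    (h0 : R ≠ 0) : 2 * Real.log D ≤ hgt R := by
  rcases R with _ | ⟨x, y, h⟩
  · exact absurd Point.zero_def.symm h0
  have hR := hR x y h rfl
  have hdvd : D ^ 2 ∣ x.den := by
    rw [Nat.dvd_iff_prime_pow_dvd_dvd]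
    intro p k hp hk
    rcases Nat.eq_zero_or_pos k with rfl | hk0
    · simp
    have : Fact p.Prime := ⟨hp⟩
    have hpD : p ∣ D := hp.dvd_of_dvd_pow ((dvd_pow_self p hk0.ne').trans hk)
    have L := hR p hp hpD
    have hk' : ((p ^ k : ℕ) : ℤ) ∣ ((D ^ 2 : ℕ) : ℤ) := by exact_mod_cast hk
    rw [padicNorm.dvd_iff_norm_le] at hk'
    have : ((p ^ k : ℕ) : ℤ) ∣ (x.den : ℤ) := by
      rw [padicNorm.dvd_iff_norm_le]
      refine le_trans ?_ hk'
      push_cast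
      rw [pn_sq]
      unfold Lc at L
      have hx : x * x.den = x.num := Rat.mul_den_eq_num x
      have h1 := congrArg (padicNorm p) hx
      rw [padicNorm.mul] at h1
      have h2 := padicNorm.of_int (p := p) x.num
      have n1 : 0 ≤ padicNorm p (x.den : ℚ) := padicNorm.nonneg _
      calc padicNorm p (x.den : ℚ) = padicNorm p (x.den : ℚ) * 1 := by ring
        _ ≤ padicNorm p (x.den : ℚ) * (padicNorm p x * padicNorm p D ^ 2) := by gcongr
        _ = padicNorm p x.num * padicNorm p D ^ 2 := by rw [← h1]; ring
        _ ≤ 1 * padicNorm p D ^ 2 := by gcongr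
        _ = _ := by ring
    exact_mod_cast this
  have hle : D ^ 2 ≤ max x.num.natAbs x.den :=
    (Nat.le_of_dvd x.den_pos hdvd).trans (le_max_right _ _)
  rw [hgt_some]
  have : 2 * Real.log D = Real.log ((D ^ 2 : ℕ) : ℝ) := by push_cast; rw [Real.log_pow]; norm_num
  rw [this]
  apply Real.log_le_log (by positivity)
  exact_mod_cast hle

lemma fg_pigeon {G : Type*} [AddCommGroup G] (hG : AddGroup.FG G) : ∃ B : ℕ, ∀ Λ : AddSubgroup G,
    ∀ S : Finset G, (∀ P ∈ S, P ∈ Λ) → B < S.card →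
      ∃ P ∈ S, ∃ Q ∈ S, P ≠ Q ∧ ∃ R ∈ Λ, P - Q = (R + R) + (R + R) := by
  classical
  have hfin : Module.Finite ℤ G := Module.Finite.iff_addGroup_fg.mpr hG
  obtain ⟨n, φ, hφ⟩ := Module.Finite.exists_fin' ℤ G
  refine ⟨4 ^ n, fun Λ S hS hB => ?_⟩
  let N : Submodule ℤ (Fin n → ℤ) := (AddSubgroup.toIntSubmodule Λ).comap φ
  obtain ⟨m, ⟨b⟩⟩ := Submodule.nonempty_basis_of_pid (Pi.basisFun ℤ (Fin n)) N
  have hmn : m ≤ n := by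
    have h1 := Submodule.finrank_le N
    rw [Module.finrank_eq_card_basis b] at h1
    simpa using h1
  have lift : ∀ P : Λ, ∃ v : N, φ v = P := by
    rintro ⟨P, hP⟩
    obtain ⟨v, hv⟩ := hφ P
    refine ⟨⟨v, ?_⟩, hv⟩
    change φ v ∈ Λ
    rw [hv]; exact hP
  choose ψ hψ using lift
  let col : Λ → (Fin m → ZMod 4) := fun P i => ((b.repr (ψ P) i : ℤ) : ZMod 4)
  let S' : Finset Λ := S.attach.image (fun P => ⟨P.1, hS P.1 P.2⟩)
  have hcard : S'.card = S.card := by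
    rw [Finset.card_image_of_injective, Finset.card_attach]
    intro P Q h
    have h' : (P : G) = Q := congrArg (fun t : Λ => (t : G)) h
    exact Subtype.ext h'
  have hlt : (Finset.univ : Finset (Fin m → ZMod 4)).card < S'.card := by
    rw [hcard, Finset.card_univ, Fintype.card_fun, ZMod.card, Fintype.card_fin]
    exact lt_of_le_of_lt (Nat.pow_le_pow_right (by norm_num) hmn) hB
  obtain ⟨P, hP, Q, hQ, hne, hPQ⟩ := Finset.exists_ne_map_eq_of_card_lt_of_maps_to hlt
    (f := col) (fun _ _ => Finset.mem_univ _)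
  have mem : ∀ P ∈ S', (P : G) ∈ S := by
    intro P hP
    obtain ⟨a, _, rfl⟩ := Finset.mem_image.mp hP
    exact a.2
  refine ⟨P, mem P hP, Q, mem Q hQ, fun h => hne (Subtype.ext h), ?_⟩
  have hd : ∀ i, ∃ k : ℤ, b.repr (ψ P) i - b.repr (ψ Q) i = 4 * k := by
    intro i
    have := congrFun hPQ i
    have h4 := (ZMod.intCast_eq_intCast_iff_dvd_sub _ _ 4).mp this.symm
    exact h4
  choose k hk using hd
  let u : N := ∑ i, k i • b i
  have hu : ψ P - ψ Q = (4 : ℤ) • u := by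
    apply b.repr.injective
    ext i
    rw [map_sub, map_smul]
    have : b.repr u i = k i := by
      simp only [u]; rw [b.repr_sum_self]
    simp [this, hk]
  refine ⟨φ u, u.2, ?_⟩
  have h4 : ∀ R : G, (R + R) + (R + R) = (4 : ℤ) • R := by
    intro R
    have : (4 : ℤ) = 1 + 1 + (1 + 1) := by norm_num
    rw [this, add_smul, add_smul, one_smul]
  rw [h4]
  rw [← hψ P, ← hψ Q, ← map_sub, ← map_smul]
  congr 1
  exact congrArg Subtype.val hu

lemma size_bound {g p t y₁ y₂ : ℤ} (hg : 0 < g) (ht : 1 ≤ t) (h1 : g * (p - t) = y₁ ^ 2)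
    (h2 : g * (p + t) = y₂ ^ 2) : p ≤ 2 * t ^ 2 := by
  by_cases hu : p - t ≤ 0
  · nlinarith
  push Not at hu
  have hsq : IsSquare ((p - t) * (p + t)) := by
    rw [← Rat.isSquare_intCast_iff]
    refine ⟨(y₁ : ℚ) * y₂ / g, ?_⟩
    have hgq : (g : ℚ) ≠ 0 := by exact_mod_cast hg.ne'
    have h1' : (g : ℚ) * (p - t) = y₁ ^ 2 := by exact_mod_cast h1
    have h2' : (g : ℚ) * (p + t) = y₂ ^ 2 := by exact_mod_cast h2
    push_cast
    field_simp
    rw [← h1', ← h2']; ring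
  obtain ⟨w, hw⟩ := hsq
  have hw' : (p - t) * (p + t) = |w| * |w| := by rw [hw, abs_mul_abs_self]
  have hw0 := abs_nonneg w
  generalize |w| = W at *
  clear hw h1 h2
  have hlt : W < p := by nlinarith
  have hgt : p - t < W := by
    by_contra h
    push Not at h
    nlinarith
  have : p ^ 2 - W ^ 2 = t ^ 2 := by nlinarith
  have h3 : p + W ≤ t ^ 2 := by nlinarith
  nlinarith

lemma key_points {r s : ℤ} (hr : 0 < r) (hrs : r < s) (hg : Good (s ^ 2) (r ^ 2)) {a g m : ℤ} {D : ℕ}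
    (hD : 0 < D) (hg0 : 0 < g) (hcop : IsCoprime a (D : ℤ))
    (hm : ∀ k ∈ ({m - r, m + r, m - s, m + s} : Set ℤ), ∃ y : ℤ, g * (a + k * D) = y ^ 2) :
    0 < a + m * D ∧ a + m * D ≤ 2 * s ^ 2 * D ^ 2 ∧
    ∃ y h, (Point.some ((((a + m * D : ℤ) : ℚ) / D) ^ 2) y h : Pt (s ^ 2) (r ^ 2)) ∈
        (Lam D hD : AddSubgroup (Pt (s ^ 2) (r ^ 2))) ∧
      hgt (Point.some ((((a + m * D : ℤ) : ℚ) / D) ^ 2) y h : Pt (s ^ 2) (r ^ 2)) ≤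
        4 * Real.log D + 2 * Real.log (2 * s ^ 2) := by
  obtain ⟨y1, h1⟩ := hm (m - r) (by simp)
  obtain ⟨y2, h2⟩ := hm (m + r) (by simp)
  obtain ⟨y3, h3⟩ := hm (m - s) (by simp)
  obtain ⟨y4, h4⟩ := hm (m + s) (by simp)
  set p : ℤ := a + m * D with hp
  have hDz : (1 : ℤ) ≤ D := by exact_mod_cast hD
  have hDq : (D : ℚ) ≠ 0 := by exact_mod_cast hD.ne'
  have hgq : (g : ℚ) ≠ 0 := by exact_mod_cast hg0.ne'
  have hsD : (1 : ℤ) ≤ s * D := by nlinarith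
  have h1' : g * (p - r * D) = y1 ^ 2 := by rw [← h1, hp]; ring
  have h2' : g * (p + r * D) = y2 ^ 2 := by rw [← h2, hp]; ring
  have h3' : g * (p - s * D) = y3 ^ 2 := by rw [← h3, hp]; ring
  have h4' : g * (p + s * D) = y4 ^ 2 := by rw [← h4, hp]; ring
  have hps : s * D ≤ p := by
    have : 0 ≤ g * (p - s * D) := by rw [h3']; positivity
    have := nonneg_of_mul_nonneg_right this hg0
    linarith
  have hpD : (D : ℤ) ≤ p := by nlinarith
  have hp0 : 0 < p := by linarith
  have hsize : p ≤ 2 * s ^ 2 * D ^ 2 := by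
    have := size_bound hg0 hsD h3' h4'
    linarith [this, mul_pow s (D : ℤ) 2]
  have copp : IsCoprime p (D : ℤ) := by
    rw [hp]; exact hcop.add_mul_right_left m
  refine ⟨hp0, hsize, ?_⟩
  have q1 : (y1 : ℚ) ^ 2 = g * (p - r * D) := by exact_mod_cast h1'.symm
  have q2 : (y2 : ℚ) ^ 2 = g * (p + r * D) := by exact_mod_cast h2'.symm
  have q3 : (y3 : ℚ) ^ 2 = g * (p - s * D) := by exact_mod_cast h3'.symm
  have q4 : (y4 : ℚ) ^ 2 = g * (p + s * D) := by exact_mod_cast h4'.symm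
  have heq : (((p : ℚ) / D) * (y1 * y2 * y3 * y4) / (g * D) ^ 2) ^ 2 =
      ((p : ℚ) / D) ^ 2 * (((p : ℚ) / D) ^ 2 - ((s ^ 2 : ℤ) : ℚ)) *
        (((p : ℚ) / D) ^ 2 - ((r ^ 2 : ℤ) : ℚ)) := by
    have : (((p : ℚ) / D) * (y1 * y2 * y3 * y4) / (g * D) ^ 2) ^ 2 =
      (p / D) ^ 2 * (y1 ^ 2 * y2 ^ 2 * y3 ^ 2 * y4 ^ 2) / (g * D) ^ 4 := by ring
    rw [this, q1, q2, q3, q4]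
    push_cast
    field_simp
    ring
  have hns := ec_ns hg heq
  refine ⟨_, hns, ?_, ?_⟩
  · intro x y h h0 q hq hqD
    injection h0 with hx _
    have : Fact q.Prime := ⟨hq⟩
    rw [← hx]
    unfold Lc
    rw [pn_sq, padicNorm.div, div_pow]
    have hD0 := (pn_D hD hqD).1
    have : padicNorm q (p : ℚ) = 1 := by
      rw [padicNorm.int_eq_one_iff]
      intro hqp
      have h5 : IsUnit (q : ℤ) := copp.isUnit_of_dvd' hqp (by exact_mod_cast hqD)
      have := Int.isUnit_iff.mp h5
      have := hq.two_le
      omega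
    rw [this]
    field_simp
    exact le_rfl
  · rw [hgt_some]
    have hx : (((p : ℚ) / D) ^ 2) = ((p ^ 2 : ℤ) : ℚ) / ((D ^ 2 : ℤ) : ℚ) := by push_cast; rw [div_pow]
    have hc : Nat.Coprime (p ^ 2).natAbs ((D : ℤ) ^ 2).natAbs :=
      Int.isCoprime_iff_nat_coprime.mp copp.pow
    have hD2 : (0 : ℤ) < (D : ℤ) ^ 2 := by positivity
    have hmax : ((max (((p : ℚ) / D) ^ 2).num.natAbs (((p : ℚ) / D) ^ 2).den : ℕ) : ℤ) ≤ p ^ 2 := by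
      rw [hx]
      have e1 := Rat.num_div_eq_of_coprime hD2 hc
      have e2 := Rat.den_div_eq_of_coprime hD2 hc
      push_cast
      push_cast at e1 e2
      rw [e1, e2]
      apply max_le
      · rw [abs_of_nonneg (by positivity)]
      · nlinarith
    have hmax' : ((max (((p : ℚ) / D) ^ 2).num.natAbs (((p : ℚ) / D) ^ 2).den : ℕ) : ℝ)
        ≤ (2 * s ^ 2 * D ^ 2) ^ 2 := by
      have h7 : p ^ 2 ≤ (2 * s ^ 2 * D ^ 2) ^ 2 := by gcongr
      have h8 := hmax.trans h7
      generalize max (((p : ℚ) / D) ^ 2).num.natAbs (((p : ℚ) / D) ^ 2).den = w at h8 ⊢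
      have h9 : ((w : ℤ) : ℝ) ≤ (((2 * s ^ 2 * (D : ℤ) ^ 2) ^ 2 : ℤ) : ℝ) := by exact_mod_cast h8
      push_cast at h9
      exact h9
    have hpos : (0 : ℝ) < ((max (((p : ℚ) / D) ^ 2).num.natAbs (((p : ℚ) / D) ^ 2).den : ℕ) : ℝ) := by
      have := Rat.den_pos (((p : ℚ) / D) ^ 2)
      have : 0 < max (((p : ℚ) / D) ^ 2).num.natAbs (((p : ℚ) / D) ^ 2).den :=
        lt_of_lt_of_le this (le_max_right _ _)
      exact_mod_cast this
    refine (Real.log_le_log hpos hmax').trans ?_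
    have hs0 : (s : ℝ) ≠ 0 := by have : s ≠ 0 := by omega
                                 exact_mod_cast this
    have hDr : (D : ℝ) ≠ 0 := by exact_mod_cast hD.ne'
    rw [Real.log_pow, Real.log_mul (by positivity) (by positivity), Real.log_pow]
    push_cast
    linarith

lemma hgt_four {e f : ℤ} {C : ℝ}
    (hC : ∀ P Q : Pt e f, |hgt (P + Q) + hgt (P - Q) - 2 * (hgt P + hgt Q)| ≤ C) (R : Pt e f) :
    16 * hgt R - 5 * C ≤ hgt ((R + R) + (R + R)) := by
  have h2 : ∀ R : Pt e f, 4 * hgt R - C ≤ hgt (R + R) := by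
    intro R
    have := hC R R
    rw [sub_self, hgt_zero, abs_le] at this
    linarith [this.1]
  linarith [h2 R, h2 (R + R)]

lemma key_bound {r s : ℤ} (hr : 0 < r) (hrs : r < s) : ∃ B : ℕ, ∀ a d : ℤ, 1 ≤ d → ∀ M : Finset ℤ,
    (∀ m ∈ M, ∀ k ∈ ({m - r, m + r, m - s, m + s} : Set ℤ), ∃ y : ℤ, a + k * d = y ^ 2) →
    M.card ≤ B := by
  have hg : Good (s ^ 2) (r ^ 2) := by
    refine ⟨?_, ?_, ?_⟩
    · have : 0 < s := by omega
      positivity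
    · positivity
    · nlinarith
  obtain ⟨C, hC⟩ := hgt_par hg
  obtain ⟨B, hB⟩ := fg_pigeon (mordell_weil hg)
  set T : ℝ := 6 * C + 8 * Real.log (2 * s ^ 2) with hT
  set D0 : ℕ := ⌈Real.exp (T / 16)⌉₊ with hD0
  refine ⟨B + (2 * s ^ 2 * D0 ^ 2).toNat, fun a d hd M hM => ?_⟩
  have hg0 : 0 < Int.gcd a d := Int.gcd_pos_of_ne_zero_right _ (by omega)
  obtain ⟨a', d', hc, ha', hd'⟩ := Int.exists_gcd_one hg0
  set g : ℤ := (Int.gcd a d : ℤ) with hgdef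
  have hgp : 0 < g := by rw [hgdef]; exact_mod_cast hg0
  have hd'0 : 0 < d' := by
    by_contra h
    push Not at h
    nlinarith
  obtain ⟨D, rfl⟩ := Int.eq_ofNat_of_zero_le hd'0.le
  have hD : 0 < D := by exact_mod_cast hd'0
  have hM' : ∀ m ∈ M, ∀ k ∈ ({m - r, m + r, m - s, m + s} : Set ℤ),
      ∃ y : ℤ, g * (a' + k * D) = y ^ 2 := by
    intro m hm k hk
    obtain ⟨y, hy⟩ := hM m hm k hk
    refine ⟨y, ?_⟩
    rw [← hy]
    conv_rhs => rw [ha', hd']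
    push_cast
    ring
  have hcop : IsCoprime a' (D : ℤ) := Int.isCoprime_iff_gcd_eq_one.mpr hc
  have pts := fun m (hm : m ∈ M) => key_points hr hrs hg hD hgp hcop (hM' m hm)
  by_cases hbig : M.card ≤ B
  · omega
  push Not at hbig
  have hex : ∃ F : ℤ → Pt (s ^ 2) (r ^ 2), ∀ m ∈ M, F m ∈ (Lam D hD : AddSubgroup _) ∧
      hgt (F m) ≤ 4 * Real.log D + 2 * Real.log (2 * s ^ 2) ∧
      ∃ y h, F m = Point.some ((((a' + m * D : ℤ) : ℚ) / D) ^ 2) y h := by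
    classical
    choose _ _ y h h1 h2 using pts
    refine ⟨fun m => if hm : m ∈ M then Point.some _ _ (h m hm) else 0, fun m hm => ?_⟩
    simp only [hm, dif_pos]
    exact ⟨h1 m hm, h2 m hm, y m hm, h m hm, rfl⟩
  obtain ⟨F, hF⟩ := hex
  have hDq : (D : ℚ) ≠ 0 := by exact_mod_cast hD.ne'
  have hinj : Set.InjOn F M := by
    intro m hm n hn hmn
    obtain ⟨_, _, y, h, e1⟩ := hF m hm
    obtain ⟨_, _, y', h', e2⟩ := hF n hn
    rw [e1, e2] at hmn
    injection hmn with hx _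
    have p1 := (pts m hm).1
    have p2 := (pts n hn).1
    have p1' : (0 : ℚ) < ((a' + m * D : ℤ) : ℚ) / D := by
      apply div_pos (by exact_mod_cast p1) (by positivity)
    have p2' : (0 : ℚ) < ((a' + n * D : ℤ) : ℚ) / D := by
      apply div_pos (by exact_mod_cast p2) (by positivity)
    have := (pow_left_inj₀ p1'.le p2'.le (two_ne_zero)).mp hx
    have h6 := (div_left_inj' hDq).mp this
    have h7 : a' + m * D = a' + n * D := by exact_mod_cast h6
    have h8 : m * (D : ℤ) = n * D := by linarith
    exact mul_right_cancel₀ (by exact_mod_cast hD.ne') h8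
  classical
  have hcard : (M.image F).card = M.card := Finset.card_image_of_injOn hinj
  obtain ⟨P, hP, Q, hQ, hne, R, hR, hPQ⟩ := hB (Lam D hD) (M.image F) (by
    intro P hP
    obtain ⟨m, hm, rfl⟩ := Finset.mem_image.mp hP
    exact (hF m hm).1) (by rw [hcard]; exact hbig)
  obtain ⟨m, hm, rfl⟩ := Finset.mem_image.mp hP
  obtain ⟨n, hn, rfl⟩ := Finset.mem_image.mp hQ
  have hR0 : R ≠ 0 := by
    rintro rfl
    simp only [add_zero] at hPQ
    exact hne (sub_eq_zero.mp hPQ)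
  have i1 := lam_hgt hD hR hR0
  have i2 := hgt_four hC R
  have i3 := (abs_le.mp (hC (F m) (F n))).2
  have i4 := hgt_nonneg (F m + F n)
  have i5 := (hF m hm).2.1
  have i6 := (hF n hn).2.1
  rw [hPQ] at i3
  have hlog : Real.log D ≤ T / 16 := by rw [hT]; linarith
  have hDD : D ≤ D0 := by
    have h1 : (D : ℝ) ≤ Real.exp (T / 16) := by
      rw [← Real.exp_log (by exact_mod_cast hD : (0 : ℝ) < D)]
      exact Real.exp_le_exp.mpr hlog
    have h2 := Nat.le_ceil (Real.exp (T / 16))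
    exact_mod_cast h1.trans h2
  have hsub : (M.image (fun m => a' + m * D)) ⊆ Finset.Ioc 0 (2 * s ^ 2 * (D0 : ℤ) ^ 2) := by
    intro p hp
    obtain ⟨m, hm, rfl⟩ := Finset.mem_image.mp hp
    rw [Finset.mem_Ioc]
    refine ⟨(pts m hm).1, (pts m hm).2.1.trans ?_⟩
    gcongr
  have hc2 := Finset.card_le_card hsub
  rw [Finset.card_image_of_injective, Int.card_Ioc, sub_zero] at hc2
  · omega
  · intro m n h
    have h8 : m * (D : ℤ) = n * D := by simpa using h
    exact mul_right_cancel₀ (by exact_mod_cast hD.ne') h8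

end

open scoped Classical in
lemma squaresInAP_eq (N : ℕ) (a d : ℤ) : squaresInAP N a d =
    (Finset.filter (fun n : ℕ => ∃ m : ℤ, a + (n : ℤ) * d = m ^ 2) (Finset.range N)).card := by
  unfold squaresInAP
  symm
  apply Finset.card_bij (fun (n : ℕ) _ => (n : ℤ))
  · intro n hn
    obtain ⟨h1, h2⟩ := Finset.mem_filter.mp hn
    refine Finset.mem_filter.mpr ⟨?_, h2⟩
    simp only [Finset.bind_def, Finset.pure_def, Finset.mem_sup, Finset.mem_singleton]
    exact ⟨n, h1, rfl⟩
  · intro n _ m _ h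
    exact_mod_cast h
  · intro z hz
    obtain ⟨h1, h2⟩ := Finset.mem_filter.mp hz
    simp only [Finset.bind_def, Finset.pure_def, Finset.mem_sup, Finset.mem_singleton] at h1
    obtain ⟨n, hn, rfl⟩ := h1
    exact ⟨n, Finset.mem_filter.mpr ⟨hn, h2⟩, rfl⟩

lemma comb_pattern {t K : ℤ} (hK : 0 ≤ K) {A : Finset ℤ} (hA : A ⊆ Finset.Ico t (t + K))
    (hc : 24 * K < (A.card : ℤ) ^ 2) : ∃ m r s : ℤ, 0 < r ∧ r < s ∧ s < K ∧ t ≤ m ∧ m < t + K ∧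
      m - r ∈ A ∧ m + r ∈ A ∧ m - s ∈ A ∧ m + s ∈ A := by
  classical
  obtain ⟨A', hA', ε, hpar, hc'⟩ : ∃ A' ⊆ A, ∃ ε : ℤ, (∀ x ∈ A', x % 2 = ε) ∧
      6 * K < (A'.card : ℤ) ^ 2 := by
    have h := Finset.card_filter_add_card_filter_not (s := A) (fun x : ℤ => x % 2 = 0)
    by_cases h0 : A.card ≤ 2 * (A.filter (fun x : ℤ => x % 2 = 0)).card
    · refine ⟨_, Finset.filter_subset _ _, 0, fun x hx => (Finset.mem_filter.mp hx).2, ?_⟩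
      have : (A.card : ℤ) ≤ 2 * (A.filter (fun x : ℤ => x % 2 = 0)).card := by exact_mod_cast h0
      nlinarith
    · refine ⟨A.filter (fun x : ℤ => ¬ x % 2 = 0), Finset.filter_subset _ _, 1, ?_, ?_⟩
      · intro x hx
        have := (Finset.mem_filter.mp hx).2
        omega
      · have : (A.card : ℤ) ≤ 2 * (A.filter (fun x : ℤ => ¬ x % 2 = 0)).card := by
          have : A.card ≤ 2 * (A.filter (fun x : ℤ => ¬ x % 2 = 0)).card := by omega
          exact_mod_cast this
        nlinarith
  let col : ℤ × ℤ → ℤ × Fin 3 := fun p =>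
    (p.1 + p.2, if p.1 < p.2 then 0 else if p.1 = p.2 then 1 else 2)
  have hmaps : ∀ p ∈ A' ×ˢ A', col p ∈ Finset.Ico (2 * t) (2 * t + 2 * K) ×ˢ Finset.univ := by
    intro p hp
    obtain ⟨h1, h2⟩ := Finset.mem_product.mp hp
    have h1 := Finset.mem_Ico.mp (hA (hA' h1))
    have h2 := Finset.mem_Ico.mp (hA (hA' h2))
    simp only [col, Finset.mem_product, Finset.mem_Ico, Finset.mem_univ, and_true]
    omega
  have hlt : (Finset.Ico (2 * t) (2 * t + 2 * K) ×ˢ (Finset.univ : Finset (Fin 3))).card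
      < (A' ×ˢ A').card := by
    rw [Finset.card_product, Finset.card_product, Int.card_Ico, Finset.card_univ, Fintype.card_fin]
    zify
    rw [Int.toNat_of_nonneg (by omega)]
    nlinarith
  obtain ⟨p, hp, q, hq, hne, hpq⟩ := Finset.exists_ne_map_eq_of_card_lt_of_maps_to hlt hmaps
  obtain ⟨x, y⟩ := p
  obtain ⟨z, w⟩ := q
  obtain ⟨hx, hy⟩ := Finset.mem_product.mp hp
  obtain ⟨hz, hw⟩ := Finset.mem_product.mp hq
  simp only at hx hy hz hw
  have main : ∀ x y z w : ℤ, x ∈ A' → y ∈ A' → z ∈ A' → w ∈ A' → x < z → z < w → w < y →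
      x + y = z + w → ∃ m r s : ℤ, 0 < r ∧ r < s ∧ s < K ∧ t ≤ m ∧ m < t + K ∧
      m - r ∈ A ∧ m + r ∈ A ∧ m - s ∈ A ∧ m + s ∈ A := by
    intro x y z w hx hy hz hw h1 h2 h3 h4
    have px := hpar x hx
    have py := hpar y hy
    have pz := hpar z hz
    have pw := hpar w hw
    have bx := Finset.mem_Ico.mp (hA (hA' hx))
    have hby := Finset.mem_Ico.mp (hA (hA' hy))
    refine ⟨(x + y) / 2, (w - z) / 2, (y - x) / 2, by omega, by omega, by omega, by omega,
      by omega, ?_, ?_, ?_, ?_⟩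
    · have : (x + y) / 2 - (w - z) / 2 = z := by omega
      rw [this]; exact hA' hz
    · have : (x + y) / 2 + (w - z) / 2 = w := by omega
      rw [this]; exact hA' hw
    · have : (x + y) / 2 - (y - x) / 2 = x := by omega
      rw [this]; exact hA' hx
    · have : (x + y) / 2 + (y - x) / 2 = y := by omega
      rw [this]; exact hA' hy
  have hs : x + y = z + w := congrArg Prod.fst hpq
  have ho : (if x < y then (0 : Fin 3) else if x = y then 1 else 2)
    = if z < w then 0 else if z = w then 1 else 2 := congrArg Prod.snd hpq
  have hne' : x ≠ z := by
    rintro rfl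
    apply hne
    have : y = w := by omega
    rw [this]
  rcases lt_trichotomy x y with h | h | h <;> rcases lt_trichotomy z w with h' | h' | h'
  · rcases lt_or_gt_of_ne hne' with h3 | h3
    · exact main x y z w hx hy hz hw h3 h' (by omega) hs
    · exact main z w x y hz hw hx hy h3 h (by omega) hs.symm
  · rw [if_pos h, if_neg (by omega), if_pos h'] at ho; simp at ho
  · rw [if_pos h, if_neg (by omega), if_neg (by omega)] at ho; simp at ho
  · rw [if_neg (by omega), if_pos h, if_pos h'] at ho; simp at ho
  · omega
  · rw [if_neg (by omega), if_pos h, if_neg (by omega), if_neg (by omega)] at ho; simp at ho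
  · rw [if_neg (by omega), if_neg (by omega), if_pos h'] at ho; simp at ho
  · rw [if_neg (by omega), if_neg (by omega), if_neg (by omega), if_pos h'] at ho; simp at ho
  · rcases lt_or_gt_of_ne hne' with h3 | h3
    · exact main w z y x hw hz hy hx (by omega) h (by omega) (by omega)
    · exact main y x w z hy hx hw hz (by omega) h' (by omega) (by omega)

lemma rich_bound (K : ℕ) (hK : 0 < K) : ∃ B : ℕ, ∀ a d : ℤ, 1 ≤ d → ∀ J : Finset ℕ, ∀ W : ℕ → Finset ℕ,
    (∀ j ∈ J, W j ⊆ Finset.Ico (j * K) (j * K + K)) →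
    (∀ j ∈ J, ∀ n ∈ W j, ∃ y : ℤ, a + (n : ℤ) * d = y ^ 2) →
    (∀ j ∈ J, 24 * K < (W j).card ^ 2) → J.card ≤ B := by
  classical
  have hb : ∀ r s : ℤ, ∃ B : ℕ, 0 < r → r < s → ∀ a d : ℤ, 1 ≤ d → ∀ M : Finset ℤ,
    (∀ m ∈ M, ∀ k ∈ ({m - r, m + r, m - s, m + s} : Set ℤ), ∃ y : ℤ, a + k * d = y ^ 2) →
    M.card ≤ B := by
    intro r s
    by_cases h : 0 < r ∧ r < s
    · obtain ⟨B, hB⟩ := key_bound h.1 h.2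
      exact ⟨B, fun _ _ => hB⟩
    · exact ⟨0, fun h1 h2 => absurd ⟨h1, h2⟩ h⟩
  choose Bd hBd using hb
  let T : Finset (ℤ × ℤ) := Finset.Ioo 0 (K : ℤ) ×ˢ Finset.Ioo 0 (K : ℤ)
  refine ⟨∑ p ∈ T, Bd p.1 p.2, fun a d hd J W hW hsq hrich => ?_⟩
  have pat : ∀ j : ℕ, ∃ q : ℤ × ℤ × ℤ, j ∈ J → 0 < q.2.1 ∧ q.2.1 < q.2.2 ∧ q.2.2 < K ∧
      (j : ℤ) * K ≤ q.1 ∧ q.1 < j * K + K ∧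
      ∀ k ∈ ({q.1 - q.2.1, q.1 + q.2.1, q.1 - q.2.2, q.1 + q.2.2} : Set ℤ),
        ∃ y : ℤ, a + k * d = y ^ 2 := by
    intro j
    by_cases hj : j ∈ J
    · let A : Finset ℤ := (W j).image (fun n : ℕ => (n : ℤ))
      have hAc : A.card = (W j).card := Finset.card_image_of_injective _ Nat.cast_injective
      have hA : A ⊆ Finset.Ico ((j : ℤ) * K) (j * K + K) := by
        intro x hx
        obtain ⟨n, hn, rfl⟩ := Finset.mem_image.mp hx
        have := Finset.mem_Ico.mp (hW j hj hn)
        rw [Finset.mem_Ico]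
        exact_mod_cast this
      have hAs : ∀ k ∈ A, ∃ y : ℤ, a + k * d = y ^ 2 := by
        intro x hx
        obtain ⟨n, hn, rfl⟩ := Finset.mem_image.mp hx
        exact hsq j hj n hn
      obtain ⟨m, r, s, h1, h2, h3, h4, h5, m1, m2, m3, m4⟩ :=
        comb_pattern (by positivity) hA (by rw [hAc]; exact_mod_cast hrich j hj)
      refine ⟨(m, r, s), fun _ => ⟨h1, h2, h3, h4, h5, ?_⟩⟩
      intro k hk
      simp only [Set.mem_insert_iff, Set.mem_singleton_iff] at hk
      rcases hk with rfl | rfl | rfl | rfl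
      · exact hAs _ m1
      · exact hAs _ m2
      · exact hAs _ m3
      · exact hAs _ m4
    · exact ⟨0, fun h => absurd h hj⟩
  choose q hq using pat
  rw [Finset.card_eq_sum_card_fiberwise (f := fun j => (q j).2) (t := T)]
  · apply Finset.sum_le_sum
    rintro ⟨r, s⟩ hrs
    by_cases hne : (J.filter (fun j => (q j).2 = (r, s))).Nonempty
    · obtain ⟨j0, hj0⟩ := hne
      obtain ⟨hj0, e0⟩ := Finset.mem_filter.mp hj0
      have h0 := hq j0 hj0
      rw [e0] at h0
      have hinj : Set.InjOn (fun j => (q j).1) (J.filter (fun j => (q j).2 = (r, s))) := by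
        intro i hi j hj hij
        obtain ⟨hi, _⟩ := Finset.mem_filter.mp hi
        obtain ⟨hj, _⟩ := Finset.mem_filter.mp hj
        have hi := hq i hi
        have hj := hq j hj
        simp only at hij
        rw [hij] at hi
        have k1 : (i : ℤ) * K < j * K + K := lt_of_le_of_lt hi.2.2.2.1 hj.2.2.2.2.1
        have k2 : (j : ℤ) * K < i * K + K := lt_of_le_of_lt hj.2.2.2.1 hi.2.2.2.2.1
        have hK' : (0 : ℤ) < K := by exact_mod_cast hK
        have k3 : (i : ℤ) < j + 1 := by nlinarith
        have k4 : (j : ℤ) < i + 1 := by nlinarith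
        omega
      have := hBd r s h0.1 h0.2.1 a d hd
        ((J.filter (fun j => (q j).2 = (r, s))).image (fun j => (q j).1)) (by
          intro m hm
          obtain ⟨j, hj, rfl⟩ := Finset.mem_image.mp hm
          obtain ⟨hj, e⟩ := Finset.mem_filter.mp hj
          have h1 := hq j hj
          rw [e] at h1
          exact h1.2.2.2.2.2)
      rw [Finset.card_image_of_injOn hinj] at this
      exact this
    · rw [Finset.not_nonempty_iff_eq_empty] at hne
      rw [hne]; simp
  · intro j hj
    have := hq j hj
    simp only [T, Finset.coe_product, Finset.coe_Ioo, Set.mem_prod, Set.mem_Ioo]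
    omega

theorem szemeredi_squares (δ : ℝ) (hδ : 0 < δ) :
    ∃ N₀ : ℕ, ∀ N : ℕ, N₀ ≤ N →
      ∀ a d : ℤ, 1 ≤ d → (squaresInAP N a d : ℝ) < δ * N := by
  classical
  obtain ⟨L, hL⟩ := exists_nat_gt (2 / δ)
  have hL0 : 0 < L := by
    have : (0 : ℝ) < L := lt_trans (by positivity) hL
    exact_mod_cast this
  have hLr : (0 : ℝ) < L := by exact_mod_cast hL0
  set K : ℕ := 24 * L ^ 2 with hKdef
  have hK : 0 < K := by positivity
  obtain ⟨B, hB⟩ := rich_bound K hK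
  obtain ⟨N₀, hN₀⟩ := exists_nat_gt ((B * K + 24 * L : ℝ) * (2 / δ))
  refine ⟨N₀ + 1, fun N hN a d hd => ?_⟩
  set S := Finset.filter (fun n : ℕ => ∃ m : ℤ, a + (n : ℤ) * d = m ^ 2) (Finset.range N) with hS
  have hcard : squaresInAP N a d = S.card := by
    rw [squaresInAP_eq, hS]
  let W : ℕ → Finset ℕ := fun j => S.filter (fun n => n / K = j)
  have hWsub : ∀ j, W j ⊆ Finset.Ico (j * K) (j * K + K) := by
    intro j n hn
    have h1 := (Finset.mem_filter.mp hn).2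
    rw [Finset.mem_Ico]
    have h2 := Nat.div_add_mod n K
    have h3 := Nat.mod_lt n hK
    rw [h1, mul_comm] at h2
    omega
  have hWK : ∀ j, (W j).card ≤ K := by
    intro j
    have := Finset.card_le_card (hWsub j)
    simpa using this
  let J := (Finset.range (N / K + 1)).filter (fun j => 24 * K < (W j).card ^ 2)
  have hJ : J.card ≤ B := by
    apply hB a d hd J W (fun j _ => hWsub j)
    · intro j _ n hn
      exact (Finset.mem_filter.mp (Finset.mem_filter.mp hn).1).2
    · intro j hj
      exact (Finset.mem_filter.mp hj).2
  have hsum : S.card = ∑ j ∈ Finset.range (N / K + 1), (W j).card := by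
    apply Finset.card_eq_sum_card_fiberwise
    intro n hn
    have : n < N := Finset.mem_range.mp (Finset.mem_filter.mp hn).1
    simp only [Finset.coe_range, Set.mem_Iio]
    exact Nat.lt_succ_of_le (Nat.div_le_div_right this.le)
  have hle : S.card ≤ B * K + (N / K + 1) * (24 * L) := by
    rw [hsum, ← Finset.sum_filter_add_sum_filter_not _ (fun j => 24 * K < (W j).card ^ 2)]
    apply Nat.add_le_add
    · calc ∑ j ∈ J, (W j).card ≤ ∑ _j ∈ J, K := Finset.sum_le_sum (fun j _ => hWK j)
        _ = J.card * K := by rw [Finset.sum_const, smul_eq_mul]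
        _ ≤ B * K := Nat.mul_le_mul_right _ hJ
    · refine (Finset.sum_le_card_nsmul _ _ (24 * L) ?_).trans ?_
      · intro j hj
        have h1 := (Finset.mem_filter.mp hj).2
        rw [hKdef] at h1
        by_contra h2
        push Not at h2
        apply h1
        nlinarith
      · rw [smul_eq_mul]
        apply Nat.mul_le_mul_right
        exact (Finset.card_filter_le _ _).trans (by rw [Finset.card_range])
  rw [hcard]
  have hNK : ((N / K : ℕ) : ℝ) ≤ N / K := Nat.cast_div_le
  have hle' : (S.card : ℝ) ≤ B * K + ((N / K : ℕ) + 1) * (24 * L) := by exact_mod_cast hle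
  have hKr : (K : ℝ) = 24 * L ^ 2 := by rw [hKdef]; push_cast; ring
  have hNL : ((N / K : ℕ) : ℝ) * (24 * L) ≤ N / L := by
    calc ((N / K : ℕ) : ℝ) * (24 * L) ≤ (N / K : ℝ) * (24 * L) := by gcongr
      _ = N / L := by rw [hKr]; field_simp
  have hN1 : (N₀ : ℝ) + 1 ≤ N := by exact_mod_cast hN
  have hNpos : (0 : ℝ) < N := by
    have : (0 : ℝ) ≤ N₀ := Nat.cast_nonneg _
    linarith
  have hA : (B * K + 24 * L : ℝ) < N * (δ / 2) := by
    have : (B * K + 24 * L : ℝ) * (2 / δ) < N := by linarith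
    calc (B * K + 24 * L : ℝ) = (B * K + 24 * L : ℝ) * (2 / δ) * (δ / 2) := by field_simp
      _ < N * (δ / 2) := by gcongr
  have hBd : (N : ℝ) / L < N * (δ / 2) := by
    rw [div_lt_iff₀ hLr]
    have : 2 < L * δ := by rwa [div_lt_iff₀ hδ] at hL
    nlinarith
  linarith
end
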